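/- arXiv:2406.09748 — 9 statements merged into one kernel-verified Lean document; each statement's English description precedes it below -/
import Mathlib

section
/- Let X be a compact metrizable topological space and let Δ be a set of Borel probability measures on X. The following four conditions are equivalent: (1) for every closed set V ⊆ X and every open set U ⊆ X with V ⊆ U there is a closed set V' with V ⊆ V' ⊆ U and μ(∂V') = 0 for all μ ∈ Δ; (2) for every closed set V and every open set U with V ⊆ U there is an open set V' with V ⊆ V' ⊆ U and μ(∂V') = 0 for all μ ∈ Δ; (3) for every x ∈ X and every open set U containing x there is a closed neighbourhood V of x (i.e. a closed set V with x in its interior) with V ⊆ U and μ(∂V) = 0 for all μ ∈ Δ; (4) for every x ∈ X and every open set U containing x there is an open neighbourhood V of x with V ⊆ U and μ(∂V) = 0 for all μ ∈ Δ. -/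
open MeasureTheory Filter Topology
open scoped NNReal ENNReal

/-- A union of two sets with null frontiers has null frontier. -/
lemma measure_frontier_union_eq_zero {X : Type*} [TopologicalSpace X] [MeasurableSpace X]
    {μ : ProbabilityMeasure X} {s t : Set X} (hs : μ (frontier s) = 0) (ht : μ (frontier t) = 0) :
    μ (frontier (s ∪ t)) = 0 := by
  rw [ProbabilityMeasure.null_iff_toMeasure_null] at *
  exact measure_mono_null ((frontier_union_subset s t).trans
    (Set.union_subset_union Set.inter_subset_left Set.inter_subset_right))
    (measure_union_null hs ht)

theorem sbp_conditions_tfae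
    {X : Type*} [TopologicalSpace X] [CompactSpace X] [TopologicalSpace.MetrizableSpace X]
    [MeasurableSpace X] [BorelSpace X]
    (Δ : Set (ProbabilityMeasure X)) :
    List.TFAE
      [ (∀ V U : Set X, IsClosed V → IsOpen U → V ⊆ U →
          ∃ V' : Set X, IsClosed V' ∧ V ⊆ V' ∧ V' ⊆ U ∧
            ∀ μ ∈ Δ, μ (frontier V') = 0),
        (∀ V U : Set X, IsClosed V → IsOpen U → V ⊆ U →
          ∃ V' : Set X, IsOpen V' ∧ V ⊆ V' ∧ V' ⊆ U ∧
            ∀ μ ∈ Δ, μ (frontier V') = 0),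
        (∀ (x : X) (U : Set X), IsOpen U → x ∈ U →
          ∃ V : Set X, IsClosed V ∧ x ∈ interior V ∧ V ⊆ U ∧
            ∀ μ ∈ Δ, μ (frontier V) = 0),
        (∀ (x : X) (U : Set X), IsOpen U → x ∈ U →
          ∃ V : Set X, IsOpen V ∧ x ∈ V ∧ V ⊆ U ∧
            ∀ μ ∈ Δ, μ (frontier V) = 0) ] := by
  have mono_null {μ : ProbabilityMeasure X} {s t : Set X} (hst : s ⊆ t) (ht : μ t = 0) :
      μ s = 0 := by
    rw [ProbabilityMeasure.null_iff_toMeasure_null] at *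
    exact measure_mono_null hst ht
  tfae_have 1 → 3 := by
    intro h x U hU hx
    obtain ⟨K, hK, hKc, hKU⟩ := exists_mem_nhds_isClosed_subset (hU.mem_nhds hx)
    obtain ⟨V, hV, hKV, hVU, hμ⟩ := h K U hKc hU hKU
    exact ⟨V, hV, interior_mono hKV (mem_interior_iff_mem_nhds.2 hK), hVU, hμ⟩
  tfae_have 3 → 4 := by
    intro h x U hU hx
    obtain ⟨V, -, hxV, hVU, hμ⟩ := h x U hU hx
    exact ⟨interior V, isOpen_interior, hxV, interior_subset.trans hVU,
      fun μ hm => mono_null frontier_interior_subset (hμ μ hm)⟩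
  tfae_have 4 → 2 := by
    intro h V U hV hU hVU
    refine hV.isCompact.induction_on
      (p := fun s => ∃ W : Set X, IsOpen W ∧ s ⊆ W ∧ W ⊆ U ∧ ∀ μ ∈ Δ, μ (frontier W) = 0)
      ⟨∅, isOpen_empty, subset_rfl, Set.empty_subset U, by simp⟩ ?_ ?_ ?_
    · rintro s t hst ⟨W, hW, htW, hWU⟩
      exact ⟨W, hW, hst.trans htW, hWU⟩
    · rintro s t ⟨W, hW, hsW, hWU, hμ⟩ ⟨W', hW', htW, hWU', hμ'⟩
      exact ⟨W ∪ W', hW.union hW', Set.union_subset_union hsW htW, Set.union_subset hWU hWU',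
        fun μ hm => measure_frontier_union_eq_zero (hμ μ hm) (hμ' μ hm)⟩
    · intro x hx
      obtain ⟨W, hW, hxW, hWU⟩ := h x U hU (hVU hx)
      exact ⟨W, mem_nhdsWithin_of_mem_nhds (hW.mem_nhds hxW), W, hW, subset_rfl, hWU⟩
  tfae_have 2 → 1 := by
    intro h V U hV hU hVU
    obtain ⟨W, hW, hVW, hWU⟩ := normal_exists_closure_subset hV hU hVU
    obtain ⟨V', -, hVV', hV'W, hμ⟩ := h V W hV hW hVW
    exact ⟨closure V', isClosed_closure, hVV'.trans subset_closure,
      (closure_mono hV'W).trans hWU,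
      fun μ hm => mono_null frontier_closure_subset (hμ μ hm)⟩
  tfae_finish
end

section
/- Let X be a compact metrizable topological space, let Δ be a set of Borel probability measures on X which is closed in the weak-* topology (the topology of weak convergence of measures), let c ≥ 0 be a real number, and let V ⊆ X be a closed set such that μ(V) < c for every μ ∈ Δ. Then there is an open set U ⊆ X with V ⊆ U and μ(U) < c for every μ ∈ Δ. -/
open MeasureTheory Filter Topology
open scoped NNReal ENNReal

/-- If a closed set `V` has `μ`-measure less than `c`, then some open neighbourhood of `V` has
measure less than `c` for all probability measures close to `μ`. -/
lemma exists_open_nbhd_eventually_measure_lt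
    {X : Type*} [TopologicalSpace X] [TopologicalSpace.PseudoMetrizableSpace X]
    [MeasurableSpace X] [BorelSpace X] {c : ℝ≥0} {V : Set X} (hV : IsClosed V)
    {μ : ProbabilityMeasure X} (hμ : μ V < c) :
    ∃ U : Set X, IsOpen U ∧ V ⊆ U ∧ ∀ᶠ ν in 𝓝 μ, ν U < c := by
  let := TopologicalSpace.pseudoMetrizableSpacePseudoMetric X
  have hμ' : (μ : Measure X) V < c := by
    rw [← ProbabilityMeasure.ennreal_coeFn_eq_coeFn_toMeasure]
    exact_mod_cast hμ
  obtain ⟨W, hVW, hW, hμW⟩ := V.exists_isOpen_lt_of_lt (c : ℝ≥0∞) hμ'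
  obtain ⟨U, hU, hVU, hUW⟩ := normal_exists_closure_subset hV hW hVW
  refine ⟨U, hU, hVU, ?_⟩
  have hlim := (ProbabilityMeasure.limsup_measure_closed_le_of_tendsto
    (tendsto_id (x := 𝓝 μ)) (isClosed_closure (s := U))).trans_lt
    ((measure_mono hUW).trans_lt hμW)
  filter_upwards [eventually_lt_of_limsup_lt hlim] with ν hν
  have hνU := (measure_mono (subset_closure (s := U))).trans_lt hν
  rw [id, ← ProbabilityMeasure.ennreal_coeFn_eq_coeFn_toMeasure] at hνU
  exact_mod_cast hνU

theorem exists_open_nbhd_of_closed_small_measure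
    {X : Type*} [TopologicalSpace X] [CompactSpace X] [TopologicalSpace.MetrizableSpace X]
    [MeasurableSpace X] [BorelSpace X]
    (Δ : Set (ProbabilityMeasure X)) (hΔ : IsClosed Δ)
    (c : ℝ) (hc : 0 ≤ c) (V : Set X) (hV : IsClosed V)
    (hsmall : ∀ μ ∈ Δ, (μ V : ℝ) < c) :
    ∃ U : Set X, IsOpen U ∧ V ⊆ U ∧ ∀ μ ∈ Δ, (μ U : ℝ) < c := by
  lift c to ℝ≥0 using hc
  simp only [NNReal.coe_lt_coe] at hsmall ⊢
  refine hΔ.isCompact.induction_on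
    (p := fun s ↦ ∃ U : Set X, IsOpen U ∧ V ⊆ U ∧ ∀ μ ∈ s, μ U < c)
    ⟨Set.univ, isOpen_univ, Set.subset_univ V, by simp⟩ ?_ ?_ ?_
  · rintro s t hst ⟨U, hU, hVU, h⟩
    exact ⟨U, hU, hVU, fun μ hμ ↦ h μ (hst hμ)⟩
  · rintro s t ⟨U, hU, hVU, hs⟩ ⟨W, hW, hVW, ht⟩
    refine ⟨U ∩ W, hU.inter hW, Set.subset_inter hVU hVW, ?_⟩
    rintro μ (hμ | hμ)
    · exact (μ.apply_mono Set.inter_subset_left).trans_lt (hs μ hμ)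
    · exact (μ.apply_mono Set.inter_subset_right).trans_lt (ht μ hμ)
  · intro μ hμ
    obtain ⟨U, hU, hVU, h⟩ := exists_open_nbhd_eventually_measure_lt hV (hsmall μ hμ)
    exact ⟨_, mem_nhdsWithin_of_mem_nhds h, U, hU, hVU, fun ν hν ↦ hν⟩
end

section
/- Let X be a compact metrizable topological space and let Δ be a weak-*-closed set of Borel probability measures on X. If (X, Δ) has the small boundary property, then for every finite open cover U_1, ..., U_m of X and every ε > 0 there exist continuous functions φ_1, ..., φ_m : X → [0,1] such that: (1) φ_1(x) + ... + φ_m(x) = 1 for all x ∈ X; (2) the support of φ_i (the closure of {x : φ_i(x) ≠ 0}) is contained in U_i for each i = 1, ..., m; and (3) μ(⋃_{i=1}^m φ_i^{-1}((0,1))) < ε for all μ ∈ Δ. -/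
open MeasureTheory Filter Topology
open scoped NNReal ENNReal

/-- The pair `(X, Δ)` has the small boundary property. -/
def SmallBoundaryProperty {X : Type*} [TopologicalSpace X] [MeasurableSpace X]
    (Δ : Set (ProbabilityMeasure X)) : Prop :=
  ∀ (x : X) (U : Set X), IsOpen U → x ∈ U →
    ∃ V : Set X, IsClosed V ∧ x ∈ interior V ∧ V ⊆ U ∧
      ∀ μ ∈ Δ, μ (frontier V) = 0

/-- On the space of probability measures, evaluation at a closed set is upper semicontinuous. -/
theorem isOpen_setOf_measure_lt_of_isClosed {X : Type*} [TopologicalSpace X]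
    [MeasurableSpace X] [OpensMeasurableSpace X] [HasOuterApproxClosed X]
    {C : Set X} (hC : IsClosed C) (a : ℝ≥0∞) :
    IsOpen {μ : ProbabilityMeasure X | (μ : Measure X) C < a} := by
  rw [isOpen_iff_mem_nhds]
  intro μ hμ
  exact eventually_lt_of_limsup_lt
    ((ProbabilityMeasure.limsup_measure_closed_le_of_tendsto tendsto_id hC).trans_lt hμ)

/-- A closed set with small measure for every member of a compact set of probability measures has
an open neighbourhood with uniformly small measure. -/
theorem exists_isOpen_superset_measure_lt_of_isCompact {X : Type*} [TopologicalSpace X]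
    [TopologicalSpace.MetrizableSpace X] [MeasurableSpace X] [BorelSpace X]
    {S : Set (ProbabilityMeasure X)} (hS : IsCompact S) {F : Set X} (hF : IsClosed F)
    {a : ℝ≥0∞} (hSF : ∀ μ ∈ S, (μ : Measure X) F < a) :
    ∃ O : Set X, IsOpen O ∧ F ⊆ O ∧ ∀ μ ∈ S, (μ : Measure X) O < a := by
  let := TopologicalSpace.metrizableSpaceMetric X
  obtain ⟨δ, hδ_anti, hδ_pos, hδ_lim⟩ := exists_seq_strictAnti_tendsto (0 : ℝ)
  obtain ⟨n, hn⟩ := hS.elim_directed_cover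
    (fun n => {μ : ProbabilityMeasure X | (μ : Measure X) (Metric.cthickening (δ n) F) < a})
    (fun n => isOpen_setOf_measure_lt_of_isClosed Metric.isClosed_cthickening a)
    (fun μ hμ => by
      have h := (tendsto_measure_cthickening_of_isClosed (μ := (μ : Measure X)) (s := F)
        ⟨1, one_pos, measure_ne_top _ _⟩ hF).comp hδ_lim
      exact Set.mem_iUnion.2 (h.eventually_lt_const (hSF μ hμ)).exists)
    (Monotone.directed_le fun i j hij μ hμ =>
      (measure_mono (Metric.cthickening_mono (hδ_anti.antitone hij) F)).trans_lt hμ)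
  exact ⟨Metric.thickening (δ n) F, Metric.isOpen_thickening,
    Metric.self_subset_thickening (hδ_pos n) F, fun μ hμ =>
      (measure_mono (Metric.thickening_subset_cthickening _ _)).trans_lt (hn hμ)⟩

theorem frontier_biUnion_finset_subset {X ι : Type*} [TopologicalSpace X] (t : Finset ι)
    {V : ι → Set X} (hV : ∀ i ∈ t, IsClosed (V i)) :
    frontier (⋃ i ∈ t, V i) ⊆ ⋃ i ∈ t, frontier (V i) := by
  have hclosed : IsClosed (⋃ i ∈ t, V i) := t.finite_toSet.isClosed_biUnion hV
  rw [hclosed.frontier_eq]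
  rintro x ⟨hx, hx'⟩
  obtain ⟨i, hi, hxi⟩ := Set.mem_iUnion₂.1 hx
  refine Set.mem_iUnion₂.2 ⟨i, hi, ?_⟩
  rw [(hV i hi).frontier_eq]
  exact ⟨hxi, fun h => hx' (interior_mono (Set.subset_biUnion_of_mem (u := V) hi) h)⟩

/-- Under the small boundary property, a finite open cover has a closed refinement, indexed by the
same set, whose boundaries lie in a closed set that is null for every measure in `Δ`. -/
theorem SmallBoundaryProperty.exists_closed_refinement {X : Type*} [TopologicalSpace X]
    [CompactSpace X] [MeasurableSpace X] {Δ : Set (ProbabilityMeasure X)}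
    (h : SmallBoundaryProperty Δ) {ι : Type*} {U : ι → Set X} (hUopen : ∀ i, IsOpen (U i))
    (hUcover : (⋃ i, U i) = Set.univ) :
    ∃ (K : ι → Set X) (F : Set X), (∀ i, IsClosed (K i)) ∧ (∀ i, K i ⊆ U i) ∧
      (⋃ i, K i) = Set.univ ∧ IsClosed F ∧ (∀ i, frontier (K i) ⊆ F) ∧
      ∀ μ ∈ Δ, (μ : Measure X) F = 0 := by
  classical
  choose i hi using Set.iUnion_eq_univ_iff.1 hUcover
  choose V hVc hxV hVU hVμ using fun x => h x (U (i x)) (hUopen _) (hi x)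
  obtain ⟨t, ht⟩ := isCompact_univ.elim_finite_subcover (fun x => interior (V x))
    (fun x => isOpen_interior) (fun x _ => Set.mem_iUnion.2 ⟨x, hxV x⟩)
  refine ⟨fun j => ⋃ x ∈ t.filter (i · = j), V x, ⋃ x ∈ t, frontier (V x),
    fun j => (Finset.finite_toSet _).isClosed_biUnion fun x _ => hVc x, fun j => ?_, ?_,
    t.finite_toSet.isClosed_biUnion fun x _ => isClosed_frontier, fun j => ?_, fun μ hμ => ?_⟩
  · refine Set.iUnion₂_subset fun x hx => ?_
    rw [← (Finset.mem_filter.1 hx).2]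
    exact hVU x
  · refine Set.iUnion_eq_univ_iff.2 fun y => ?_
    obtain ⟨x, hx, hy⟩ := Set.mem_iUnion₂.1 (ht (Set.mem_univ y))
    exact ⟨i x, Set.mem_iUnion₂.2
      ⟨x, Finset.mem_filter.2 ⟨hx, rfl⟩, interior_subset hy⟩⟩
  · exact (frontier_biUnion_finset_subset _ fun x _ => hVc x).trans
      (Set.biUnion_subset_biUnion_left fun x hx => (Finset.mem_filter.1 hx).1)
  · exact (measure_biUnion_null_iff t.countable_toSet).2 fun x _ =>
      (ProbabilityMeasure.null_iff_toMeasure_null μ _).1 (hVμ x μ hμ)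

/-- A closed set `K` inside an open set `U` has a bump function supported in `U` that takes only
the values `0` and `1` off a given open neighbourhood of the boundary of `K`. -/
theorem IsClosed.exists_bump_of_frontier_subset {X : Type*} [TopologicalSpace X] [CompactSpace X]
    [R1Space X] {K U O : Set X} (hK : IsClosed K) (hU : IsOpen U) (hO : IsOpen O) (hKU : K ⊆ U)
    (hKO : frontier K ⊆ O) :
    ∃ f : C(X, ℝ), tsupport f ⊆ U ∧ Set.EqOn f 1 K ∧ (∀ x, f x ∈ Set.Icc (0 : ℝ) 1) ∧
      ∀ x ∉ O, f x = 0 ∨ f x = 1 := by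
  have hsub : K ⊆ U ∩ (interior K ∪ O) := fun x hx => ⟨hKU hx, by
    by_cases hxi : x ∈ interior K
    · exact Or.inl hxi
    · exact Or.inr (hKO (hK.frontier_eq ▸ ⟨hx, hxi⟩))⟩
  obtain ⟨f, hfs, hf1, hf⟩ := exists_tsupport_one_of_isOpen_isClosed
    (hU.inter (isOpen_interior.union hO)) isClosed_closure.isCompact hK hsub
  refine ⟨f, hfs.trans Set.inter_subset_left, hf1, hf, fun x hx => ?_⟩
  by_cases hxK : x ∈ K
  · exact Or.inr (hf1 hxK)
  · refine Or.inl (image_eq_zero_of_notMem_tsupport fun h => ?_)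
    rcases (hfs h).2 with h | h
    exacts [hxK (interior_subset h), hx h]

theorem sbp_partition_of_unity
    {X : Type*} [TopologicalSpace X] [CompactSpace X] [TopologicalSpace.MetrizableSpace X]
    [MeasurableSpace X] [BorelSpace X]
    (Δ : Set (ProbabilityMeasure X)) (hΔ : IsClosed Δ)
    (hSBP : SmallBoundaryProperty Δ)
    (m : ℕ) (U : Fin m → Set X) (hUopen : ∀ i, IsOpen (U i))
    (hUcover : (⋃ i, U i) = Set.univ) (ε : ℝ) (hε : 0 < ε) :
    ∃ φ : Fin m → C(X, ℝ),
      (∀ i x, φ i x ∈ Set.Icc (0 : ℝ) 1) ∧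
      (∀ x : X, (∑ i, φ i x) = 1) ∧
      (∀ i, tsupport (φ i) ⊆ U i) ∧
      (∀ μ ∈ Δ, (μ (⋃ i, (φ i) ⁻¹' Set.Ioo (0 : ℝ) 1) : ℝ) < ε) := by
  obtain ⟨K, F, hKc, hKU, hKcover, hFc, hKF, hFμ⟩ :=
    hSBP.exists_closed_refinement hUopen hUcover
  obtain ⟨O, hO, hFO, hOμ⟩ := exists_isOpen_superset_measure_lt_of_isCompact hΔ.isCompact hFc
    (a := ENNReal.ofReal ε) fun μ hμ => by simpa [hFμ μ hμ] using hε
  choose f hfU hfK hf hfO using fun i =>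
    (hKc i).exists_bump_of_frontier_subset (hUopen i) hO (hKU i) ((hKF i).trans hFO)
  let φ : Fin m → C(X, ℝ) := fun i => f i * ∏ j with j < i, (1 - f j)
  have hφ : ∀ i x, φ i x = f i x * ∏ j with j < i, (1 - f j x) := fun i x => by
    simp [φ, ContinuousMap.prod_apply]
  refine ⟨φ, fun i x => ?_, fun x => ?_, fun i => ?_, fun μ hμ => ?_⟩
  · have h0 : ∀ j ∈ Finset.univ.filter (· < i), 0 ≤ 1 - f j x := fun j _ =>
      sub_nonneg.2 (hf j x).2
    rw [hφ]
    exact ⟨mul_nonneg (hf i x).1 (Finset.prod_nonneg h0),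
      mul_le_one₀ (hf i x).2 (Finset.prod_nonneg h0)
        (Finset.prod_le_one h0 fun j _ => sub_le_self _ (hf j x).1)⟩
  · obtain ⟨i, hi⟩ := Set.iUnion_eq_univ_iff.1 hKcover x
    have h := Finset.prod_one_sub_ordered Finset.univ fun i => f i x
    rw [Finset.prod_eq_zero (Finset.mem_univ i) (by simp [hfK i hi])] at h
    simp only [hφ]
    linarith
  · refine (closure_mono fun x hx => ?_).trans (hfU i)
    rw [Function.mem_support, hφ] at hx
    exact left_ne_zero_of_mul hx
  · have hsub : (⋃ i, (φ i) ⁻¹' Set.Ioo (0 : ℝ) 1) ⊆ O := by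
      refine Set.iUnion_subset fun i x hx => by_contra fun hxO => ?_
      have hval : φ i x = 0 ∨ φ i x = 1 := by
        have hprod : ∏ j with j < i, (1 - f j x) = 0 ∨ ∏ j with j < i, (1 - f j x) = 1 := by
          refine Finset.prod_induction _ (fun y : ℝ => y = 0 ∨ y = 1) ?_ (Or.inr rfl)
            fun j _ => ?_
          · rintro a b (rfl | rfl) (rfl | rfl) <;> simp
          · rcases hfO j x hxO with h | h <;> simp [h]
        rw [hφ]
        rcases hfO i x hxO with h | h <;> rcases hprod with h' | h' <;> simp [h, h']
      rcases hval with h | h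
      exacts [hx.1.ne' h, hx.2.ne h]
    have h := (measure_mono hsub).trans_lt (hOμ μ hμ)
    rwa [← ProbabilityMeasure.ennreal_coeFn_eq_coeFn_toMeasure, ← ENNReal.ofReal_coe_nnreal,
      ENNReal.ofReal_lt_ofReal_iff hε] at h
end

section
/- Let X be a compact metrizable topological space and let Δ be a weak-*-closed set of Borel probability measures on X. Then (X, Δ) has the small boundary property if and only if for every continuous function f : X → ℝ and every ε > 0 there is a continuous function g : X → ℝ such that (1) ‖f − g‖_∞ < ε, and (2) μ(g^{-1}(0)) < ε for all μ ∈ Δ. -/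
open MeasureTheory Filter Topology
open scoped NNReal ENNReal

namespace MeasureTheory.ProbabilityMeasure

theorem coe_lt_iff_coe_measure_lt_ofReal {X : Type*} [MeasurableSpace X]
    (μ : ProbabilityMeasure X) (s : Set X) {ε : ℝ} :
    (μ s : ℝ) < ε ↔ (μ : Measure X) s < ENNReal.ofReal ε := by
  rw [← ennreal_coeFn_eq_coeFn_toMeasure, ENNReal.ofReal, ENNReal.coe_lt_coe,
    Real.lt_toNNReal_iff_coe_lt]

variable {X : Type*} [TopologicalSpace X] [MeasurableSpace X]

/-- A uniform form of outer regularity: a closed set that is uniformly small for a compact family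
of probability measures has a uniformly small open neighbourhood. -/
theorem exists_isOpen_forall_lt_of_isCompact [TopologicalSpace.PseudoMetrizableSpace X]
    [BorelSpace X] {Δ : Set (ProbabilityMeasure X)} (hΔ : IsCompact Δ) {K : Set X}
    (hK : IsClosed K) {r : ℝ≥0∞} (h : ∀ μ ∈ Δ, (μ : Measure X) K < r) :
    ∃ T : Set X, IsOpen T ∧ K ⊆ T ∧ ∀ μ ∈ Δ, (μ : Measure X) T < r := by
  let := TopologicalSpace.pseudoMetrizableSpacePseudoMetric X
  refine hΔ.induction_on (p := fun s ↦ ∃ T : Set X, IsOpen T ∧ K ⊆ T ∧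
    ∀ μ ∈ s, (μ : Measure X) T < r) ⟨Set.univ, isOpen_univ, Set.subset_univ K, by simp⟩ ?_ ?_ ?_
  · rintro s t hst ⟨T, hT, hKT, H⟩
    exact ⟨T, hT, hKT, fun μ hμ ↦ H μ (hst hμ)⟩
  · rintro s t ⟨S, hS, hKS, HS⟩ ⟨T, hT, hKT, HT⟩
    refine ⟨S ∩ T, hS.inter hT, Set.subset_inter hKS hKT, ?_⟩
    rintro μ (hμ | hμ)
    · exact (measure_mono Set.inter_subset_left).trans_lt (HS μ hμ)
    · exact (measure_mono Set.inter_subset_right).trans_lt (HT μ hμ)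
  · intro μ hμ
    obtain ⟨U, hKU, hU, hμU⟩ := K.exists_isOpen_lt_of_lt r (h μ hμ)
    obtain ⟨T, hT, hKT, hTU⟩ := normal_exists_closure_subset hK hU hKU
    have hlim := limsup_measure_closed_le_of_tendsto (tendsto_id (x := 𝓝 μ))
      (isClosed_closure (s := T))
    have hev : ∀ᶠ ν : ProbabilityMeasure X in 𝓝 μ, (ν : Measure X) (closure T) < r :=
      eventually_lt_of_limsup_lt (hlim.trans_lt ((measure_mono hTU).trans_lt hμU))
    exact ⟨_, mem_nhdsWithin_of_mem_nhds hev, T, hT, hKT,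
      fun ν hν ↦ (measure_mono subset_closure).trans_lt hν⟩

/-- The continuous functions whose zero set is uniformly small for a compact family of probability
measures form an open set. -/
theorem isOpen_setOf_forall_measure_zeroSet_lt [CompactSpace X]
    [TopologicalSpace.PseudoMetrizableSpace X] [BorelSpace X] {Δ : Set (ProbabilityMeasure X)}
    (hΔ : IsCompact Δ) (r : ℝ≥0∞) :
    IsOpen {g : C(X, ℝ) | ∀ μ ∈ Δ, (μ : Measure X) ((g : X → ℝ) ⁻¹' {0}) < r} := by
  rw [isOpen_iff_mem_nhds]
  intro g hg
  obtain ⟨T, hT, hgT, H⟩ := exists_isOpen_forall_lt_of_isCompact hΔ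
    (isClosed_singleton.preimage g.continuous) hg
  have hmaps : Set.MapsTo g Tᶜ {0}ᶜ := fun x hx hx0 ↦ hx (hgT hx0)
  filter_upwards [ContinuousMap.eventually_mapsTo hT.isClosed_compl.isCompact
    isOpen_compl_singleton hmaps] with g' hg' μ hμ
  refine (measure_mono fun x hx ↦ ?_).trans_lt (H μ hμ)
  by_contra hxT
  exact hg' hxT hx

end MeasureTheory.ProbabilityMeasure

namespace SmallBoundaryProperty

variable {X : Type*} [TopologicalSpace X] [MeasurableSpace X] {Δ : Set (ProbabilityMeasure X)}

theorem exists_isClosed_between (h : SmallBoundaryProperty Δ) {K U : Set X} (hK : IsCompact K)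
    (hU : IsOpen U) (hKU : K ⊆ U) :
    ∃ V : Set X, IsClosed V ∧ K ⊆ interior V ∧ V ⊆ U ∧ ∀ μ ∈ Δ, μ (frontier V) = 0 := by
  refine hK.induction_on (p := fun s ↦ ∃ V : Set X, IsClosed V ∧ s ⊆ interior V ∧ V ⊆ U ∧
    ∀ μ ∈ Δ, μ (frontier V) = 0) ⟨∅, by simp⟩ ?_ ?_ ?_
  · rintro s t hst ⟨V, hV, htV, H⟩
    exact ⟨V, hV, hst.trans htV, H⟩
  · rintro s t ⟨V, hV, hsV, hVU, HV⟩ ⟨W, hW, htW, hWU, HW⟩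
    refine ⟨V ∪ W, hV.union hW, ?_, Set.union_subset hVU hWU, fun μ hμ ↦ ?_⟩
    · exact Set.union_subset (hsV.trans (interior_mono Set.subset_union_left))
        (htW.trans (interior_mono Set.subset_union_right))
    · have hsub : frontier (V ∪ W) ⊆ frontier V ∪ frontier W :=
        (frontier_union_subset V W).trans
          (Set.union_subset_union Set.inter_subset_left Set.inter_subset_right)
      have h1 := HV μ hμ
      have h2 := HW μ hμ
      rw [ProbabilityMeasure.null_iff_toMeasure_null] at h1 h2 ⊢
      exact measure_mono_null hsub (measure_union_null h1 h2)
  · intro x hx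
    obtain ⟨V, hV, hxV, hVU, H⟩ := h x U hU (hKU hx)
    exact ⟨interior V, mem_nhdsWithin_of_mem_nhds (isOpen_interior.mem_nhds hxV), V, hV,
      subset_rfl, hVU, H⟩

theorem exists_norm_sub_lt [CompactSpace X] [TopologicalSpace.PseudoMetrizableSpace X]
    [BorelSpace X] (h : SmallBoundaryProperty Δ) (hΔ : IsCompact Δ) (f : C(X, ℝ)) {ε : ℝ}
    (hε : 0 < ε) {r : ℝ≥0∞} (hr : 0 < r) :
    ∃ g : C(X, ℝ), ‖f - g‖ < ε ∧ ∀ μ ∈ Δ, (μ : Measure X) ((g : X → ℝ) ⁻¹' {0}) < r := by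
  obtain ⟨V, hV, hfV, hVf, hnull⟩ := h.exists_isClosed_between
    (K := f ⁻¹' Set.Ici 0) (U := f ⁻¹' Set.Ioi (-(ε / 2)))
    (isClosed_Ici.preimage f.continuous).isCompact (isOpen_Ioi.preimage f.continuous)
    (Set.preimage_mono (Set.Ici_subset_Ioi.2 (by linarith)))
  obtain ⟨T, hT, hVT, H⟩ := ProbabilityMeasure.exists_isOpen_forall_lt_of_isCompact hΔ
    (isClosed_frontier (s := V)) (r := r) fun μ hμ ↦ by
      rwa [(ProbabilityMeasure.null_iff_toMeasure_null μ _).1 (hnull μ hμ)]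
  obtain ⟨k, hk0, hk1, hk⟩ := exists_continuous_zero_one_of_isClosed
    (s := V \ T) (t := (interior V)ᶜ \ T)
    (hV.sdiff hT) (isOpen_interior.isClosed_compl.sdiff hT) <| by
      rw [Set.disjoint_left]
      rintro x ⟨hxV, hxT⟩ ⟨hxV', -⟩
      exact hxT (hVT (hV.frontier_eq ▸ ⟨hxV, hxV'⟩))
  refine ⟨f + (ε / 2) • (1 - (2 : ℝ) • k), ?_, fun μ hμ ↦
    (measure_mono fun x hx ↦ ?_).trans_lt (H μ hμ)⟩
  · rw [ContinuousMap.norm_lt_iff _ hε]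
    intro x
    have := hk x
    rw [Real.norm_eq_abs, abs_lt]
    simp only [ContinuousMap.sub_apply, ContinuousMap.add_apply, ContinuousMap.smul_apply,
      ContinuousMap.one_apply, smul_eq_mul]
    constructor <;> nlinarith [this.1, this.2]
  · by_contra hxT
    simp only [Set.mem_preimage, Set.mem_singleton_iff, ContinuousMap.sub_apply,
      ContinuousMap.add_apply, ContinuousMap.smul_apply, ContinuousMap.one_apply,
      smul_eq_mul] at hx
    by_cases hxV : x ∈ V
    · have h1 : -(ε / 2) < f x := hVf hxV
      have h2 : k x = 0 := hk0 ⟨hxV, hxT⟩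
      rw [h2] at hx
      linarith
    · have hxV' : x ∉ interior V := fun hx' ↦ hxV (interior_subset hx')
      have h1 : f x < 0 := not_le.1 fun hx' ↦ hxV' (hfV hx')
      have h2 : k x = 1 := hk1 ⟨hxV', hxT⟩
      rw [h2] at hx
      linarith

end SmallBoundaryProperty

theorem smallBoundaryProperty_of_dense {X : Type*} [TopologicalSpace X] [CompactSpace X]
    [T2Space X] [MeasurableSpace X] {Δ : Set (ProbabilityMeasure X)}
    (h : Dense {g : C(X, ℝ) | ∀ μ ∈ Δ, (μ : Measure X) ((g : X → ℝ) ⁻¹' {0}) = 0}) :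
    SmallBoundaryProperty Δ := by
  intro x U hU hxU
  obtain ⟨k, hk0, hk1, -⟩ := exists_continuous_zero_one_of_isClosed (s := {x}) (t := Uᶜ)
    isClosed_singleton hU.isClosed_compl (Set.disjoint_singleton_left.2 (not_not.2 hxU))
  have hkx : k x = 0 := hk0 rfl
  obtain ⟨g, hg, hdist⟩ := h.exists_dist_lt (1 - (2 : ℝ) • k) one_pos
  have hdist' (y : X) : |1 - 2 * k y - g y| < 1 :=
    (ContinuousMap.dist_apply_le_dist y).trans_lt hdist
  refine ⟨g ⁻¹' Set.Ici 0, isClosed_Ici.preimage g.continuous, ?_, fun y hy ↦ ?_, fun μ hμ ↦ ?_⟩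
  · refine interior_maximal (Set.preimage_mono Set.Ioi_subset_Ici_self)
      (isOpen_Ioi.preimage g.continuous) ?_
    have := abs_lt.1 (hdist' x)
    rw [hkx] at this
    rw [Set.mem_preimage, Set.mem_Ioi]
    linarith
  · by_contra hyU
    have hy0 : 0 ≤ g y := hy
    have hky : k y = 1 := hk1 hyU
    have := abs_lt.1 (hdist' y)
    rw [hky] at this
    linarith
  · rw [ProbabilityMeasure.null_iff_toMeasure_null]
    refine measure_mono_null ((g.continuous.frontier_preimage_subset _).trans ?_) (hg μ hμ)
    rw [frontier_Ici]

theorem sbp_iff_sup_norm_approx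
    {X : Type*} [TopologicalSpace X] [CompactSpace X] [TopologicalSpace.MetrizableSpace X]
    [MeasurableSpace X] [BorelSpace X]
    (Δ : Set (ProbabilityMeasure X)) (hΔ : IsClosed Δ) :
    SmallBoundaryProperty Δ ↔
      ∀ (f : C(X, ℝ)) (ε : ℝ), 0 < ε →
        ∃ g : C(X, ℝ), ‖f - g‖ < ε ∧ ∀ μ ∈ Δ, (μ ((g : X → ℝ) ⁻¹' {0}) : ℝ) < ε := by
  have hc : IsCompact Δ := hΔ.isCompact
  constructor
  · intro h f ε hε
    obtain ⟨g, hfg, hg⟩ := h.exists_norm_sub_lt hc f hε (ENNReal.ofReal_pos.2 hε)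
    exact ⟨g, hfg, fun μ hμ ↦ (μ.coe_lt_iff_coe_measure_lt_ofReal _).2 (hg μ hμ)⟩
  · intro h
    have hdense : Dense (⋂ n : ℕ, {g : C(X, ℝ) | ∀ μ ∈ Δ,
        (μ : Measure X) ((g : X → ℝ) ⁻¹' {0}) < ENNReal.ofReal (1 / (n + 1))}) := by
      refine dense_iInter_of_isOpen
        (fun n ↦ ProbabilityMeasure.isOpen_setOf_forall_measure_zeroSet_lt hc _) fun n ↦ ?_
      have hn : (0 : ℝ) < 1 / (n + 1) := Nat.one_div_pos_of_nat
      refine Metric.dense_iff.2 fun f ε hε ↦ ?_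
      obtain ⟨g, hfg, hg⟩ := h f (min ε (1 / (n + 1))) (lt_min hε hn)
      refine ⟨g, ?_, fun μ hμ ↦ (μ.coe_lt_iff_coe_measure_lt_ofReal _).1
        ((hg μ hμ).trans_le (min_le_right _ _))⟩
      rw [Metric.mem_ball', dist_eq_norm]
      exact hfg.trans_le (min_le_left _ _)
    refine smallBoundaryProperty_of_dense (hdense.mono fun g hg μ hμ ↦ ?_)
    have hlim : Tendsto (fun n : ℕ ↦ ENNReal.ofReal (1 / ((n : ℝ) + 1))) atTop (𝓝 0) := by
      simpa using ENNReal.tendsto_ofReal (tendsto_one_div_add_atTop_nhds_zero_nat (𝕜 := ℝ))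
    exact nonpos_iff_eq_zero.1 (ge_of_tendsto' hlim fun n ↦ (Set.mem_iInter.1 hg n μ hμ).le)
end

section
/- Let X be a compact metrizable topological space, let Δ be a set of Borel probability measures on X, let ε > 0, and let f, g : X → ℝ be continuous functions satisfying ‖f − g‖_{2,Δ}² < ε³/8 and μ(g^{-1}(0)) < ε/2 for all μ ∈ Δ. Then there is a continuous function g' : X → ℝ such that (1) ‖f − g'‖_∞ < ε, and (2) μ((g')^{-1}(0)) < ε for all μ ∈ Δ. -/
open MeasureTheory Filter Topology
open scoped NNReal ENNReal

/-- The uniform 2-seminorm `‖h‖_{2,Δ} = sup_{μ ∈ Δ} (∫ |h|² dμ)^{1/2}`. -/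
noncomputable def uniformTraceNorm {X : Type*} [TopologicalSpace X] [MeasurableSpace X]
    (Δ : Set (ProbabilityMeasure X)) (h : C(X, ℝ)) : ℝ :=
  ⨆ μ ∈ Δ, Real.sqrt (∫ x, (h x) ^ 2 ∂(μ : Measure X))

section UniformTraceNorm

variable {X : Type*} [TopologicalSpace X] [CompactSpace X] [MeasurableSpace X] [BorelSpace X]

theorem integrable_continuousMap_sq (μ : ProbabilityMeasure X) (h : C(X, ℝ)) :
    Integrable (fun x => (h x) ^ 2) (μ : Measure X) :=
  Continuous.integrable_of_hasCompactSupport (by fun_prop) (HasCompactSupport.of_compactSpace _)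

theorem sqrt_integral_sq_le_norm (μ : ProbabilityMeasure X) (h : C(X, ℝ)) :
    Real.sqrt (∫ x, (h x) ^ 2 ∂(μ : Measure X)) ≤ ‖h‖ := by
  refine Real.sqrt_le_iff.2 ⟨norm_nonneg h, ?_⟩
  calc ∫ x, (h x) ^ 2 ∂(μ : Measure X) ≤ ∫ _, ‖h‖ ^ 2 ∂(μ : Measure X) := by
        refine integral_mono (integrable_continuousMap_sq μ h) (integrable_const _) fun x => ?_
        exact sq_le_sq.2 (by simpa using h.norm_coe_le_norm x)
    _ = ‖h‖ ^ 2 := by simp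

theorem integral_sq_le_uniformTraceNorm_sq {Δ : Set (ProbabilityMeasure X)} (h : C(X, ℝ))
    {μ : ProbabilityMeasure X} (hμ : μ ∈ Δ) :
    ∫ x, (h x) ^ 2 ∂(μ : Measure X) ≤ uniformTraceNorm Δ h ^ 2 := by
  have hbdd : BddAbove (Set.range fun ν : ProbabilityMeasure X =>
      ⨆ _ : ν ∈ Δ, Real.sqrt (∫ x, (h x) ^ 2 ∂(ν : Measure X))) := by
    refine ⟨‖h‖, ?_⟩
    rintro _ ⟨ν, rfl⟩
    exact Real.iSup_le (fun _ => sqrt_integral_sq_le_norm ν h) (norm_nonneg h)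
  have hle : Real.sqrt (∫ x, (h x) ^ 2 ∂(μ : Measure X)) ≤ uniformTraceNorm Δ h := by
    unfold uniformTraceNorm
    simpa only [ciSup_pos hμ] using le_ciSup hbdd μ
  exact (Real.sqrt_le_left ((Real.sqrt_nonneg _).trans hle)).1 hle

theorem sq_mul_measure_abs_ge_le_integral_sq (μ : ProbabilityMeasure X) (h : C(X, ℝ)) {c : ℝ}
    (hc : 0 ≤ c) :
    c ^ 2 * (μ {x | c ≤ |h x|} : ℝ) ≤ ∫ x, (h x) ^ 2 ∂(μ : Measure X) := by
  have hset : {x | c ≤ |h x|} = {x | c ^ 2 ≤ (h x) ^ 2} := by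
    ext x
    simp only [Set.mem_ofPred_eq, sq_le_sq, abs_of_nonneg hc]
  rw [hset]
  exact mul_meas_ge_le_integral_of_nonneg (ae_of_all _ fun x => sq_nonneg (h x))
    (integrable_continuousMap_sq μ h) (c ^ 2)

end UniformTraceNorm

theorem sup_norm_approx_of_trace_norm_approx
    {X : Type*} [TopologicalSpace X] [CompactSpace X] [TopologicalSpace.MetrizableSpace X]
    [MeasurableSpace X] [BorelSpace X]
    (Δ : Set (ProbabilityMeasure X)) (ε : ℝ) (hε : 0 < ε)
    (f g : C(X, ℝ))
    (hfg : (uniformTraceNorm Δ (f - g)) ^ 2 < ε ^ 3 / 8)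
    (hg : ∀ μ ∈ Δ, (μ ((g : X → ℝ) ⁻¹' {0}) : ℝ) < ε / 2) :
    ∃ g' : C(X, ℝ), ‖f - g'‖ < ε ∧ ∀ μ ∈ Δ, (μ ((g' : X → ℝ) ⁻¹' {0}) : ℝ) < ε := by
  let k : C(X, ℝ) := ⟨fun x => max (-(ε / 2)) (min (ε / 2) ((f - g) x)), by fun_prop⟩
  have hk : ∀ x, k x = max (-(ε / 2)) (min (ε / 2) ((f - g) x)) := fun _ => rfl
  refine ⟨f - k, ?_, fun μ hμ => ?_⟩
  · rw [sub_sub_cancel, ContinuousMap.norm_lt_iff _ hε]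
    intro x
    have h_upper : k x ≤ ε / 2 := max_le (by linarith) (min_le_left _ _)
    have h_lower : -(ε / 2) ≤ k x := le_max_left _ _
    exact (abs_le.2 ⟨h_lower, h_upper⟩).trans_lt (half_lt_self hε)
  · have hsub : ((f - k : C(X, ℝ)) : X → ℝ) ⁻¹' {0} ⊆
        (g : X → ℝ) ⁻¹' {0} ∪ {x | ε / 2 ≤ |(f - g) x|} := by
      intro x hx
      rcases le_or_gt (ε / 2) |(f - g) x| with h | h
      · exact Or.inr h
      · left
        obtain ⟨h₁, h₂⟩ := abs_lt.1 h
        have hx' : f x - k x = 0 := hx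
        rw [hk, min_eq_right h₂.le, max_eq_right h₁.le, ContinuousMap.sub_apply,
          sub_sub_cancel] at hx'
        exact hx'
    have hunion : (μ (((f - k : C(X, ℝ)) : X → ℝ) ⁻¹' {0}) : ℝ) ≤
        μ ((g : X → ℝ) ⁻¹' {0}) + μ {x | ε / 2 ≤ |(f - g) x|} :=
      (measureReal_mono (μ := (μ : Measure X)) hsub).trans (measureReal_union_le _ _)
    have hlarge : (μ {x | ε / 2 ≤ |(f - g) x|} : ℝ) < ε / 2 := by
      have hcheb := (sq_mul_measure_abs_ge_le_integral_sq μ (f - g) (half_pos hε).le).trans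
        (integral_sq_le_uniformTraceNorm_sq (f - g) hμ)
      refine lt_of_mul_lt_mul_left ?_ (sq_nonneg (ε / 2))
      linarith [show (ε / 2) ^ 2 * (ε / 2) = ε ^ 3 / 8 by ring]
    linarith [hg μ hμ]
end

section
/- Let X be a compact metrizable topological space and let Δ be a weak-*-closed set of Borel probability measures on X. Then (X, Δ) has the small boundary property if and only if for every continuous function f : X → ℝ and every ε > 0 there is a continuous function g : X → ℝ such that (1) ‖f − g‖_{2,Δ} < ε, and (2) μ(g^{-1}(0)) < ε for all μ ∈ Δ. -/
open MeasureTheory Filter Topology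
open scoped NNReal ENNReal

section

variable {X : Type*} [TopologicalSpace X] [MeasurableSpace X]

lemma integral_sq_le_of_abs_le {h : C(X, ℝ)} {C : ℝ} (hC : ∀ x, |h x| ≤ C)
    (μ : ProbabilityMeasure X) : ∫ x, (h x) ^ 2 ∂(μ : Measure X) ≤ C ^ 2 := by
  have hsq : ∀ x, (h x) ^ 2 ≤ C ^ 2 := fun x ↦ sq_le_sq' (abs_le.1 (hC x)).1 (abs_le.1 (hC x)).2
  calc ∫ x, (h x) ^ 2 ∂(μ : Measure X) ≤ ∫ _, C ^ 2 ∂(μ : Measure X) :=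
        integral_mono_of_nonneg (.of_forall fun x ↦ sq_nonneg _) (integrable_const _)
          (.of_forall hsq)
    _ = C ^ 2 := by simp

lemma sqrt_integral_sq_le_of_abs_le {h : C(X, ℝ)} {C : ℝ} (hC0 : 0 ≤ C) (hC : ∀ x, |h x| ≤ C)
    (μ : ProbabilityMeasure X) : Real.sqrt (∫ x, (h x) ^ 2 ∂(μ : Measure X)) ≤ C :=
  Real.sqrt_le_iff.2 ⟨hC0, integral_sq_le_of_abs_le hC μ⟩

lemma uniformTraceNorm_le_of_abs_le (Δ : Set (ProbabilityMeasure X)) {h : C(X, ℝ)} {C : ℝ}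
    (hC0 : 0 ≤ C) (hC : ∀ x, |h x| ≤ C) : uniformTraceNorm Δ h ≤ C :=
  Real.iSup_le (fun μ ↦ Real.iSup_le (fun _ ↦ sqrt_integral_sq_le_of_abs_le hC0 hC μ) hC0) hC0

lemma sqrt_integral_sq_le_uniformTraceNorm [CompactSpace X] {Δ : Set (ProbabilityMeasure X)}
    (h : C(X, ℝ)) {μ : ProbabilityMeasure X} (hμ : μ ∈ Δ) :
    Real.sqrt (∫ x, (h x) ^ 2 ∂(μ : Measure X)) ≤ uniformTraceNorm Δ h := by
  have hb : ∀ ν : ProbabilityMeasure X, Real.sqrt (∫ x, (h x) ^ 2 ∂(ν : Measure X)) ≤ ‖h‖ :=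
    sqrt_integral_sq_le_of_abs_le (norm_nonneg h) h.norm_coe_le_norm
  refine le_ciSup_of_le ⟨‖h‖, ?_⟩ μ (le_ciSup_of_le ⟨‖h‖, ?_⟩ hμ le_rfl)
  · rintro _ ⟨ν, rfl⟩
    exact Real.iSup_le (fun _ ↦ hb ν) (norm_nonneg h)
  · rintro _ ⟨_, rfl⟩
    exact hb μ

/-- Chebyshev's inequality for the uniform 2-seminorm. -/
lemma sq_mul_measure_le_sq_uniformTraceNorm [CompactSpace X] [OpensMeasurableSpace X]
    {Δ : Set (ProbabilityMeasure X)} (h : C(X, ℝ)) {μ : ProbabilityMeasure X} (hμ : μ ∈ Δ)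
    {η : ℝ} (hη : 0 ≤ η) :
    η ^ 2 * (μ {x | η ≤ |h x|} : ℝ) ≤ uniformTraceNorm Δ h ^ 2 := by
  have hint : Integrable (fun x ↦ (h x) ^ 2) (μ : Measure X) :=
    (h ^ 2).continuous.integrable_of_hasCompactSupport (.of_compactSpace _)
  have hset : {x | η ≤ |h x|} = {x | η ^ 2 ≤ (h x) ^ 2} := by
    ext x
    simp only [Set.mem_ofPred_eq]
    rw [sq_le_sq, abs_of_nonneg hη]
  calc η ^ 2 * (μ {x | η ≤ |h x|} : ℝ) ≤ ∫ x, (h x) ^ 2 ∂(μ : Measure X) := by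
        rw [hset]
        exact mul_meas_ge_le_integral_of_nonneg (.of_forall fun x ↦ sq_nonneg _) hint _
    _ ≤ uniformTraceNorm Δ h ^ 2 := by
        rw [← Real.sqrt_le_sqrt_iff (sq_nonneg _)]
        exact (sqrt_integral_sq_le_uniformTraceNorm h hμ).trans (Real.le_sqrt_of_sq_le le_rfl)

/-- If a closed set has measure less than `ε` for every member of a compact set of probability
measures, then so does some open neighbourhood of it. -/
lemma IsCompact.exists_isOpen_superset_measure_lt [NormalSpace X] [HasOuterApproxClosed X]
    [OpensMeasurableSpace X] {Δ : Set (ProbabilityMeasure X)} (hΔ : IsCompact Δ)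
    (houter : ∀ μ ∈ Δ, (μ : Measure X).OuterRegular) {K : Set X} (hK : IsClosed K) {ε : ℝ}
    (h : ∀ μ ∈ Δ, (μ K : ℝ) < ε) :
    ∃ N, IsOpen N ∧ K ⊆ N ∧ ∀ μ ∈ Δ, (μ N : ℝ) < ε := by
  refine hΔ.induction_on (p := fun S ↦ ∃ N, IsOpen N ∧ K ⊆ N ∧ ∀ μ ∈ S, (μ N : ℝ) < ε)
    ⟨Set.univ, isOpen_univ, Set.subset_univ _, by simp⟩ ?_ ?_ ?_
  · rintro S T hST ⟨N, hN, hKN, hT⟩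
    exact ⟨N, hN, hKN, fun μ hμ ↦ hT μ (hST hμ)⟩
  · rintro S T ⟨N, hN, hKN, hS⟩ ⟨M, hM, hKM, hT⟩
    refine ⟨N ∩ M, hN.inter hM, Set.subset_inter hKN hKM, ?_⟩
    rintro μ (hμ | hμ)
    · exact (NNReal.coe_le_coe.2 (μ.apply_mono Set.inter_subset_left)).trans_lt (hS μ hμ)
    · exact (NNReal.coe_le_coe.2 (μ.apply_mono Set.inter_subset_right)).trans_lt (hT μ hμ)
  · intro μ hμ
    have := houter μ hμ
    have hlt : ∀ (ν : ProbabilityMeasure X) (S : Set X),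
        (ν : Measure X) S < ENNReal.ofReal ε ↔ (ν S : ℝ) < ε := fun ν S ↦ by
      rw [← ν.ennreal_coeFn_eq_coeFn_toMeasure, ENNReal.ofReal, ENNReal.coe_lt_coe,
        Real.lt_toNNReal_iff_coe_lt]
    obtain ⟨U, hKU, hU, hμU⟩ := K.exists_isOpen_lt_of_lt _ ((hlt μ K).2 (h μ hμ))
    obtain ⟨W, hW, hKW, hWU⟩ := normal_exists_closure_subset hK hU hKU
    have hlim := ProbabilityMeasure.limsup_measure_closed_le_of_tendsto
      (tendsto_id (x := 𝓝 μ)) (isClosed_closure (s := W))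
    have hev := eventually_lt_of_limsup_lt
      (hlim.trans_lt ((measure_mono hWU).trans_lt hμU))
    refine ⟨_, mem_nhdsWithin_of_mem_nhds hev, W, hW, hKW, fun ν hν ↦ (hlt ν W).1 ?_⟩
    exact (measure_mono subset_closure).trans_lt hν

/-- The small boundary property separates compact sets from the complements of their open
neighbourhoods. -/
lemma SmallBoundaryProperty.exists_isClosed_of_isCompact {Δ : Set (ProbabilityMeasure X)}
    (h : SmallBoundaryProperty Δ) {A U : Set X} (hA : IsCompact A) (hU : IsOpen U) (hAU : A ⊆ U) :
    ∃ V, IsClosed V ∧ A ⊆ interior V ∧ V ⊆ U ∧ ∀ μ ∈ Δ, μ (frontier V) = 0 := by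
  refine hA.induction_on (p := fun A ↦ ∃ V, IsClosed V ∧ A ⊆ interior V ∧ V ⊆ U ∧
    ∀ μ ∈ Δ, μ (frontier V) = 0) ⟨∅, by simp⟩ ?_ ?_ ?_
  · rintro S T hST ⟨V, hV, hTV, hVU⟩
    exact ⟨V, hV, hST.trans hTV, hVU⟩
  · rintro S T ⟨V, hV, hSV, hVU, hV0⟩ ⟨W, hW, hTW, hWU, hW0⟩
    refine ⟨V ∪ W, hV.union hW, ?_, Set.union_subset hVU hWU, fun μ hμ ↦ ?_⟩
    · exact (Set.union_subset_union hSV hTW).trans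
        (Set.union_subset (interior_mono Set.subset_union_left)
          (interior_mono Set.subset_union_right))
    · have hsub : frontier (V ∪ W) ⊆ frontier V ∪ frontier W :=
        (frontier_union_subset V W).trans
          (Set.union_subset_union Set.inter_subset_left Set.inter_subset_right)
      rw [ProbabilityMeasure.null_iff_toMeasure_null]
      exact measure_mono_null hsub (measure_union_null
        ((μ.null_iff_toMeasure_null _).1 (hV0 μ hμ)) ((μ.null_iff_toMeasure_null _).1 (hW0 μ hμ)))
  · intro x hx
    obtain ⟨V, hV, hxV, hVU, hV0⟩ := h x U hU (hAU hx)
    exact ⟨interior V, mem_nhdsWithin_of_mem_nhds (isOpen_interior.mem_nhds hxV),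
      V, hV, le_rfl, hVU, hV0⟩

/-- Approximations in the uniform 2-seminorm by functions with uniformly small zero sets can be
truncated to uniform approximations. -/
lemma exists_abs_sub_le_of_trace_norm_approx [CompactSpace X]
    [OpensMeasurableSpace X] {Δ : Set (ProbabilityMeasure X)}
    (h : ∀ (f : C(X, ℝ)) (ε : ℝ), 0 < ε → ∃ g : C(X, ℝ), uniformTraceNorm Δ (f - g) < ε ∧
      ∀ μ ∈ Δ, (μ ((g : X → ℝ) ⁻¹' {0}) : ℝ) < ε)
    (f : C(X, ℝ)) {η ε : ℝ} (hη : 0 < η) (hε : 0 < ε) :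
    ∃ g : C(X, ℝ), (∀ x, |f x - g x| ≤ η) ∧ ∀ μ ∈ Δ, (μ ((g : X → ℝ) ⁻¹' {0}) : ℝ) < ε := by
  obtain ⟨δ, hδ, hδ1, hδε, hδη⟩ : ∃ δ > 0, δ ≤ 1 ∧ δ ≤ ε / 2 ∧ δ ≤ η ^ 2 * (ε / 2) :=
    ⟨min 1 (min (ε / 2) (η ^ 2 * (ε / 2))), by positivity, min_le_left _ _,
      (min_le_right _ _).trans (min_le_left _ _), (min_le_right _ _).trans (min_le_right _ _)⟩
  obtain ⟨g, hfg, hg⟩ := h f δ hδ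
  refine ⟨(f - .const X η) ⊔ (g ⊓ (f + .const X η)), fun x ↦ ?_, fun μ hμ ↦ ?_⟩
  · simp only [ContinuousMap.sup_apply, ContinuousMap.inf_apply, ContinuousMap.sub_apply,
      ContinuousMap.add_apply, ContinuousMap.const_apply]
    rw [abs_sub_comm, abs_le]
    constructor
    · linarith [le_max_left (f x - η) (min (g x) (f x + η))]
    · linarith [max_le (a := f x - η) (by linarith) (min_le_right (g x) (f x + η))]
  · have hsub : ((((f - .const X η) ⊔ (g ⊓ (f + .const X η)) : C(X, ℝ)) : X → ℝ) ⁻¹' {0}) ⊆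
        (g : X → ℝ) ⁻¹' {0} ∪ {x | η ≤ |(f - g) x|} := by
      intro x hx
      replace hx : max (f x - η) (min (g x) (f x + η)) = 0 := hx
      by_contra hx'
      simp only [Set.mem_union, not_or, Set.mem_preimage, Set.mem_singleton_iff,
        Set.mem_ofPred_eq, not_le, ContinuousMap.sub_apply, abs_lt] at hx'
      obtain ⟨h0, h1, h2⟩ := hx'
      rw [min_eq_left (by linarith), max_eq_right (by linarith)] at hx
      exact h0 hx
    have hcheb := sq_mul_measure_le_sq_uniformTraceNorm (f - g) hμ hη.le
    have hnonneg : 0 ≤ uniformTraceNorm Δ (f - g) :=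
      (Real.sqrt_nonneg _).trans (sqrt_integral_sq_le_uniformTraceNorm (f - g) hμ)
    have hsmall : (μ {x | η ≤ |(f - g) x|} : ℝ) ≤ ε / 2 :=
      le_of_mul_le_mul_left (by nlinarith) (pow_pos hη 2)
    have hunion : (μ ((g : X → ℝ) ⁻¹' {0} ∪ {x | η ≤ |(f - g) x|}) : ℝ) ≤
        μ ((g : X → ℝ) ⁻¹' {0}) + μ {x | η ≤ |(f - g) x|} := measureReal_union_le _ _
    have hmono := NNReal.coe_le_coe.2 (μ.apply_mono hsub)
    linarith [hg μ hμ]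

lemma SmallBoundaryProperty.of_dense [CompactSpace X]
    [TopologicalSpace.MetrizableSpace X] {Δ : Set (ProbabilityMeasure X)}
    (h : Dense {g : C(X, ℝ) | ∀ μ ∈ Δ, μ ((g : X → ℝ) ⁻¹' {0}) = 0}) :
    SmallBoundaryProperty Δ := by
  let := TopologicalSpace.metrizableSpaceMetric X
  intro x U hU hxU
  obtain ⟨s, hs0, hs1, -⟩ := exists_continuous_zero_one_of_isClosed hU.isClosed_compl
    (isClosed_singleton (x := x)) (Set.disjoint_singleton_right.2 fun hx ↦ hx hxU)
  obtain ⟨g, hg0, hgs⟩ := h.exists_dist_lt (s - .const X (1 / 2)) (ε := 1 / 2) (by norm_num)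
  have hgs' : ∀ y, |s y - 1 / 2 - g y| < 1 / 2 := fun y ↦
    (ContinuousMap.dist_apply_le_dist y).trans_lt hgs
  refine ⟨{y | 0 ≤ g y}, isClosed_le continuous_const g.continuous, ?_, fun y hy ↦ ?_,
    fun μ hμ ↦ ?_⟩
  · refine interior_maximal (fun y (hy : 0 < g y) ↦ hy.le)
      (isOpen_lt continuous_const g.continuous) ?_
    have h1 : s x = 1 := hs1 rfl
    have h2 := abs_lt.1 (hgs' x)
    change 0 < g x
    linarith [h2.2]
  · by_contra hyU
    have h1 : s y = 0 := hs0 hyU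
    have h2 := abs_lt.1 (hgs' y)
    have h3 : 0 ≤ g y := hy
    linarith [h2.1]
  · refine le_antisymm ((μ.apply_mono fun y hy ↦ ?_).trans (hg0 μ hμ).le) zero_le
    exact (frontier_le_subset_eq continuous_const g.continuous hy).symm

variable [CompactSpace X] [TopologicalSpace.MetrizableSpace X] [BorelSpace X]

lemma exists_isOpen_superset_measure_lt_of_isClosed {Δ : Set (ProbabilityMeasure X)}
    (hΔ : IsClosed Δ) {K : Set X} (hK : IsClosed K) {ε : ℝ} (h : ∀ μ ∈ Δ, (μ K : ℝ) < ε) :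
    ∃ N, IsOpen N ∧ K ⊆ N ∧ ∀ μ ∈ Δ, (μ N : ℝ) < ε := by
  let := TopologicalSpace.metrizableSpaceMetric X
  exact hΔ.isCompact.exists_isOpen_superset_measure_lt (fun _ _ ↦ inferInstance) hK h

/-- Under the small boundary property, continuous functions are uniform limits of functions with
uniformly small zero sets. -/
lemma SmallBoundaryProperty.exists_abs_sub_le {Δ : Set (ProbabilityMeasure X)} (hΔ : IsClosed Δ)
    (h : SmallBoundaryProperty Δ) (f : C(X, ℝ)) {η ε : ℝ} (hη : 0 < η) (hε : 0 < ε) :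
    ∃ g : C(X, ℝ), (∀ x, |f x - g x| ≤ η) ∧ ∀ μ ∈ Δ, (μ ((g : X → ℝ) ⁻¹' {0}) : ℝ) < ε := by
  let := TopologicalSpace.metrizableSpaceMetric X
  obtain ⟨V, hV, hfV, hVf, hV0⟩ := h.exists_isClosed_of_isCompact
    (A := {x | 0 ≤ f x}) (U := {x | -η < f x})
    (isClosed_le continuous_const f.continuous).isCompact
    (isOpen_lt continuous_const f.continuous)
    fun x (hx : 0 ≤ f x) ↦ show -η < f x by linarith
  obtain ⟨N, hN, hVN, hNε⟩ := exists_isOpen_superset_measure_lt_of_isClosed hΔ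
    (isClosed_frontier (s := V)) fun μ hμ ↦ by simpa [hV0 μ hμ] using hε
  have hdisj : Disjoint (interior V ∪ N)ᶜ (V \ N) := by
    rw [Set.disjoint_left]
    rintro x hx ⟨hxV, hxN⟩
    exact hx (.inl (by_contra fun hxi ↦ hxN (hVN ⟨subset_closure hxV, hxi⟩)))
  obtain ⟨s, hs0, hs1, hs⟩ := exists_continuous_zero_one_of_isClosed
    (isOpen_interior.union hN).isClosed_compl (hV.sdiff hN) hdisj
  refine ⟨f + (2 * η) • s - .const X η, fun x ↦ ?_, fun μ hμ ↦ ?_⟩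
  · have := hs x
    simp only [ContinuousMap.sub_apply, ContinuousMap.add_apply, ContinuousMap.smul_apply,
      ContinuousMap.const_apply, smul_eq_mul]
    rw [abs_le]
    constructor <;> nlinarith [this.1, this.2]
  · refine (NNReal.coe_le_coe.2 (μ.apply_mono fun x hx ↦ ?_)).trans_lt (hNε μ hμ)
    by_contra hxN
    replace hx : f x + 2 * η * s x - η = 0 := hx
    by_cases hxV : x ∈ V
    · have h1 : s x = 1 := hs1 ⟨hxV, hxN⟩
      have h2 : -η < f x := hVf hxV
      rw [h1] at hx
      linarith
    · have h1 : s x = 0 := hs0 fun hx' ↦ hx'.elim (fun hi ↦ hxV (interior_subset hi)) hxN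
      have h2 : ¬ 0 ≤ f x := fun h0 ↦ hxV (interior_subset (hfV h0))
      rw [h1] at hx
      linarith

/-- Having a zero set of uniformly small measure is an open condition. -/
lemma isOpen_setOf_measure_zeroSet_lt {Δ : Set (ProbabilityMeasure X)} (hΔ : IsClosed Δ) (ε : ℝ) :
    IsOpen {g : C(X, ℝ) | ∀ μ ∈ Δ, (μ ((g : X → ℝ) ⁻¹' {0}) : ℝ) < ε} := by
  rw [Metric.isOpen_iff]
  intro g hg
  obtain ⟨N, hN, hgN, hNε⟩ := exists_isOpen_superset_measure_lt_of_isClosed hΔ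
    (isClosed_singleton.preimage g.continuous) hg
  obtain ⟨c, hc, hcN⟩ : ∃ c > 0, ∀ x ∈ Nᶜ, c ≤ |g x| :=
    hN.isClosed_compl.isCompact.exists_forall_le' g.continuous.abs.continuousOn
      fun x hx ↦ abs_pos.2 fun h0 ↦ hx (hgN h0)
  refine ⟨c, hc, fun g' hg' μ hμ ↦ ?_⟩
  refine (NNReal.coe_le_coe.2 (μ.apply_mono fun x hx ↦ ?_)).trans_lt (hNε μ hμ)
  by_contra hxN
  have h1 := (ContinuousMap.dist_apply_le_dist x).trans_lt (Metric.mem_ball.1 hg')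
  rw [Real.dist_eq, show g' x = 0 from hx, zero_sub, abs_neg] at h1
  exact (hcN x hxN).not_gt h1

/-- If continuous functions are uniform limits of functions with uniformly small zero sets, then
they are uniform limits of functions with uniformly null zero sets. -/
lemma dense_setOf_measure_zeroSet_eq_zero {Δ : Set (ProbabilityMeasure X)} (hΔ : IsClosed Δ)
    (h : ∀ (f : C(X, ℝ)) (η ε : ℝ), 0 < η → 0 < ε → ∃ g : C(X, ℝ), (∀ x, |f x - g x| ≤ η) ∧
      ∀ μ ∈ Δ, (μ ((g : X → ℝ) ⁻¹' {0}) : ℝ) < ε) :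
    Dense {g : C(X, ℝ) | ∀ μ ∈ Δ, μ ((g : X → ℝ) ⁻¹' {0}) = 0} := by
  refine (dense_iInter_of_isOpen_nat
    (fun n : ℕ ↦ isOpen_setOf_measure_zeroSet_lt hΔ (1 / ((n : ℝ) + 1))) fun n ↦ ?_).mono ?_
  · rw [Metric.dense_iff]
    intro f r hr
    obtain ⟨g, hfg, hg⟩ := h f (r / 2) (1 / ((n : ℝ) + 1)) (by positivity) (by positivity)
    refine ⟨g, ?_, hg⟩
    rw [Metric.mem_ball, dist_comm]
    exact ((ContinuousMap.dist_le (by positivity)).2 hfg).trans_lt (half_lt_self hr)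
  · intro g hg μ hμ
    rw [Set.mem_iInter] at hg
    refine NNReal.coe_injective (le_antisymm (le_of_forall_pos_lt_add fun ε hε ↦ ?_) (by simp))
    obtain ⟨n, hn⟩ := exists_nat_one_div_lt hε
    simpa using (hg n μ hμ).trans hn

end

theorem sbp_iff_trace_norm_approx
    {X : Type*} [TopologicalSpace X] [CompactSpace X] [TopologicalSpace.MetrizableSpace X]
    [MeasurableSpace X] [BorelSpace X]
    (Δ : Set (ProbabilityMeasure X)) (hΔ : IsClosed Δ) :
    SmallBoundaryProperty Δ ↔
      ∀ (f : C(X, ℝ)) (ε : ℝ), 0 < ε →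
        ∃ g : C(X, ℝ), uniformTraceNorm Δ (f - g) < ε ∧
          ∀ μ ∈ Δ, (μ ((g : X → ℝ) ⁻¹' {0}) : ℝ) < ε := by
  refine ⟨fun h f ε hε ↦ ?_, fun h ↦ ?_⟩
  · obtain ⟨g, hfg, hg⟩ := h.exists_abs_sub_le hΔ f (half_pos hε) hε
    exact ⟨g, (uniformTraceNorm_le_of_abs_le Δ (half_pos hε).le hfg).trans_lt (half_lt_self hε),
      hg⟩
  · exact .of_dense (dense_setOf_measure_zeroSet_eq_zero hΔ fun f _ _ hη hε ↦
      exists_abs_sub_le_of_trace_norm_approx h f hη hε)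
end

section
/- Let X be a compact metrizable topological space, let Δ be a weak-*-closed set of Borel probability measures on X, let g : X → ℝ be continuous, and let ε > 0. Then μ(g^{-1}(0)) < ε for all μ ∈ Δ if and only if there exists δ > 0 such that ∫_X χ_δ(g(x)) dμ(x) < ε for all μ ∈ Δ. -/
open MeasureTheory Filter Topology
open scoped NNReal ENNReal

/-- The cutoff function `χ_δ : ℝ → [0,1]`: equal to `1` for `|t| ≤ δ/2`, `0` for
`|t| ≥ δ`, and linear in between. -/
noncomputable def chiCutoff (δ t : ℝ) : ℝ :=
  max 0 (min 1 (2 - 2 * |t| / δ))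

theorem continuous_chiCutoff (δ : ℝ) : Continuous (chiCutoff δ) := by
  unfold chiCutoff
  fun_prop

theorem chiCutoff_nonneg (δ t : ℝ) : 0 ≤ chiCutoff δ t :=
  le_max_left _ _

theorem chiCutoff_le_one (δ t : ℝ) : chiCutoff δ t ≤ 1 :=
  max_le zero_le_one (min_le_left _ _)

theorem chiCutoff_zero_right (δ : ℝ) : chiCutoff δ 0 = 1 := by
  simp [chiCutoff]

theorem chiCutoff_eq_zero {δ t : ℝ} (hδ : 0 < δ) (h : δ ≤ |t|) : chiCutoff δ t = 0 := by
  have h1 : 1 ≤ |t| / δ := (one_le_div hδ).2 h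
  refine max_eq_left ((min_le_right _ _).trans ?_)
  rw [mul_div_assoc]
  linarith

theorem chiCutoff_mono {δ δ' : ℝ} (hδ : 0 < δ) (h : δ ≤ δ') (t : ℝ) :
    chiCutoff δ t ≤ chiCutoff δ' t := by
  unfold chiCutoff
  gcongr

theorem tendsto_chiCutoff_zero (t : ℝ) :
    Tendsto (fun n : ℕ => chiCutoff (1 / ((n : ℝ) + 1)) t) atTop
      (𝓝 (Set.indicator {0} 1 t)) := by
  by_cases ht : t = 0
  · simp [ht, chiCutoff_zero_right]
  · rw [Set.indicator_of_notMem (by simpa using ht)]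
    refine tendsto_const_nhds.congr' ?_
    filter_upwards [tendsto_one_div_add_atTop_nhds_zero_nat.eventually
      (gt_mem_nhds (abs_pos.2 ht))] with n hn
    exact (chiCutoff_eq_zero Nat.one_div_pos_of_nat hn.le).symm

section

variable {X : Type*} [TopologicalSpace X] [CompactSpace X] [MeasurableSpace X] [BorelSpace X]

theorem integrable_chiCutoff_comp (μ : Measure X) [IsFiniteMeasure μ] (g : C(X, ℝ)) (δ : ℝ) :
    Integrable (fun x => chiCutoff δ (g x)) μ :=
  ((continuous_chiCutoff δ).comp g.continuous).integrable_of_hasCompactSupport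
    (HasCompactSupport.of_compactSpace _)

theorem measureReal_preimage_zero_le_integral_chiCutoff (μ : Measure X) [IsFiniteMeasure μ]
    (g : C(X, ℝ)) (δ : ℝ) :
    μ.real (g ⁻¹' {0}) ≤ ∫ x, chiCutoff δ (g x) ∂μ := by
  have hZ : MeasurableSet (g ⁻¹' {0}) := g.continuous.measurable (measurableSet_singleton 0)
  rw [← integral_indicator_one hZ]
  refine integral_mono ((integrable_const 1).indicator hZ) (integrable_chiCutoff_comp μ g δ)
    fun x => Set.indicator_le' (fun y hy => ?_) (fun y _ => chiCutoff_nonneg δ (g y)) x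
  rw [show g y = 0 from hy, chiCutoff_zero_right]
  rfl

theorem tendsto_integral_chiCutoff (μ : Measure X) [IsFiniteMeasure μ] (g : C(X, ℝ)) :
    Tendsto (fun n : ℕ => ∫ x, chiCutoff (1 / ((n : ℝ) + 1)) (g x) ∂μ) atTop
      (𝓝 (μ.real (g ⁻¹' {0}))) := by
  have hZ : MeasurableSet (g ⁻¹' {0}) := g.continuous.measurable (measurableSet_singleton 0)
  rw [← integral_indicator_one hZ]
  refine tendsto_integral_of_dominated_convergence (fun _ => 1)
    (fun n => (integrable_chiCutoff_comp μ g _).aestronglyMeasurable) (integrable_const 1)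
    (fun n => ae_of_all _ fun x => ?_) (ae_of_all _ fun x => tendsto_chiCutoff_zero (g x))
  rw [Real.norm_of_nonneg (chiCutoff_nonneg _ _)]
  exact chiCutoff_le_one _ _

end

theorem zero_set_small_iff_cutoff_small
    {X : Type*} [TopologicalSpace X] [CompactSpace X] [TopologicalSpace.MetrizableSpace X]
    [MeasurableSpace X] [BorelSpace X]
    (Δ : Set (ProbabilityMeasure X)) (hΔ : IsClosed Δ)
    (g : C(X, ℝ)) (ε : ℝ) (hε : 0 < ε) :
    (∀ μ ∈ Δ, (μ ((g : X → ℝ) ⁻¹' {0}) : ℝ) < ε) ↔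
      ∃ δ : ℝ, 0 < δ ∧ ∀ μ ∈ Δ, (∫ x, chiCutoff δ (g x) ∂(μ : Measure X)) < ε := by
  constructor
  · intro h
    let U : ℕ → Set (ProbabilityMeasure X) := fun n =>
      {μ | ∫ x, chiCutoff (1 / ((n : ℝ) + 1)) (g x) ∂(μ : Measure X) < ε}
    have hU_open (n : ℕ) : IsOpen (U n) :=
      isOpen_lt (ProbabilityMeasure.continuous_integral_boundedContinuousFunction
        (BoundedContinuousFunction.mkOfCompact
          ⟨fun x => chiCutoff (1 / ((n : ℝ) + 1)) (g x),
            (continuous_chiCutoff _).comp g.continuous⟩)) continuous_const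
    have hU_mono : Monotone U := fun m n hmn μ hμ =>
      (integral_mono (integrable_chiCutoff_comp _ g _) (integrable_chiCutoff_comp _ g _)
        fun x => chiCutoff_mono Nat.one_div_pos_of_nat
          (Nat.one_div_le_one_div hmn) (g x)).trans_lt hμ
    have hU_cover : Δ ⊆ ⋃ n, U n := fun μ hμ =>
      Set.mem_iUnion.2 ((tendsto_integral_chiCutoff (μ : Measure X) g).eventually
        (gt_mem_nhds (h μ hμ))).exists
    obtain ⟨n, hn⟩ := hΔ.isCompact.elim_directed_cover U hU_open hU_cover hU_mono.directed_le
    exact ⟨1 / ((n : ℝ) + 1), Nat.one_div_pos_of_nat, fun μ hμ => hn hμ⟩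
  · rintro ⟨δ, -, h⟩ μ hμ
    exact (measureReal_preimage_zero_le_integral_chiCutoff (μ : Measure X) g δ).trans_lt (h μ hμ)
end

section
/- Let X and Y be compact metrizable topological spaces, let Δ_1 and Δ_2 be weak-*-closed sets of Borel probability measures on X and Y respectively, and let φ : C(X, ℂ) → C(Y, ℂ) be an injective unital star-algebra homomorphism such that: (1) for every μ ∈ Δ_1 there exists ν ∈ Δ_2 with ∫_X f dμ = ∫_Y φ(f) dν for all f ∈ C(X, ℂ); and (2) the image φ(C(X, ℂ)) is dense in C(Y, ℂ) with respect to the seminorm ‖h‖_{2,Δ_2} = sup_{ν∈Δ_2} (∫_Y |h|² dν)^{1/2}. If (Y, Δ_2) has the small boundary property, then (X, Δ_1) has the small boundary property. -/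
open MeasureTheory Filter Topology
open scoped NNReal ENNReal

/-- The uniform 2-seminorm `‖h‖_{2,Δ} = sup_{μ ∈ Δ} (∫ |h|² dμ)^{1/2}` for
complex-valued continuous functions. -/
noncomputable def uniformTraceNormC {Y : Type*} [TopologicalSpace Y] [MeasurableSpace Y]
    (Δ : Set (ProbabilityMeasure Y)) (h : C(Y, ℂ)) : ℝ :=
  ⨆ ν ∈ Δ, Real.sqrt (∫ y, ‖h y‖ ^ 2 ∂(ν : Measure Y))

/-- A compact set of measures that all vanish on a closed set `K` is uniformly small on some open
neighbourhood of `K`. -/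
theorem IsCompact.exists_isOpen_superset_forall_measure_lt {Y : Type*} [TopologicalSpace Y]
    [MeasurableSpace Y] [BorelSpace Y] [HasOuterApproxClosed Y]
    {Δ : Set (ProbabilityMeasure Y)} (hΔ : IsCompact Δ) {K : Set Y} (hK : IsClosed K)
    (hK0 : ∀ ν ∈ Δ, (ν : Measure Y) K = 0) {ε : ℝ≥0∞} (hε : 0 < ε) :
    ∃ W, IsOpen W ∧ K ⊆ W ∧ ∀ ν ∈ Δ, (ν : Measure Y) W < ε := by
  refine hΔ.induction_on
    (p := fun S ↦ ∃ W, IsOpen W ∧ K ⊆ W ∧ ∀ ν ∈ S, (ν : Measure Y) W < ε) ?_ ?_ ?_ ?_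
  · exact ⟨Set.univ, isOpen_univ, Set.subset_univ _, by simp⟩
  · rintro S T hST ⟨W, hW, hKW, h⟩
    exact ⟨W, hW, hKW, fun ν hν ↦ h ν (hST hν)⟩
  · rintro S T ⟨W, hW, hKW, h⟩ ⟨W', hW', hKW', h'⟩
    refine ⟨W ∩ W', hW.inter hW', Set.subset_inter hKW hKW', ?_⟩
    rintro ν (hν | hν)
    · exact (measure_mono Set.inter_subset_left).trans_lt (h ν hν)
    · exact (measure_mono Set.inter_subset_right).trans_lt (h' ν hν)
  · intro ν hν
    have hlim := HasOuterApproxClosed.tendsto_lintegral_apprSeq hK (ν : Measure Y)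
    rw [hK0 ν hν] at hlim
    have hε2 : 0 < ε / 2 := ENNReal.half_pos hε.ne'
    obtain ⟨n, hn⟩ := (hlim.eventually_lt_const hε2).exists
    refine ⟨_, mem_nhdsWithin_of_mem_nhds
      ((ProbabilityMeasure.continuous_lintegral_boundedContinuousFunction
        (hK.apprSeq n)).continuousAt.eventually_lt_const hn),
      {y | 1 / 2 < hK.apprSeq n y},
      isOpen_lt continuous_const (hK.apprSeq n).continuous, ?_, ?_⟩
    · intro y hy
      rw [Set.mem_ofPred_eq, HasOuterApproxClosed.apprSeq_apply_eq_one hK n hy]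
      exact NNReal.half_lt_self one_ne_zero
    · intro ν' hν'
      have hmarkov := mul_meas_ge_le_lintegral (μ := (ν' : Measure Y))
        (f := fun y ↦ (hK.apprSeq n y : ℝ≥0∞))
        (ENNReal.continuous_coe.comp (hK.apprSeq n).continuous).measurable (2⁻¹ : ℝ≥0∞)
      have hsub : (ν' : Measure Y) {y | 1 / 2 < hK.apprSeq n y} ≤
          (ν' : Measure Y) {y | (2⁻¹ : ℝ≥0∞) ≤ (hK.apprSeq n y : ℝ≥0∞)} := by
        refine measure_mono fun y hy ↦ ?_
        have h2 : ((1 / 2 : ℝ≥0) : ℝ≥0∞) ≤ (hK.apprSeq n y : ℝ≥0∞) :=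
          ENNReal.coe_le_coe.2 (le_of_lt hy)
        simpa using h2
      have hlt := (mul_le_mul_right hsub 2⁻¹).trans_lt (hmarkov.trans_lt hν')
      rw [ENNReal.div_eq_inv_mul] at hlt
      exact lt_of_mul_lt_mul_left' hlt

/-- In a compact space, the small boundary property separates a closed set from the complement
of an open neighbourhood. -/
theorem SmallBoundaryProperty.exists_isClosed_between_s7 {Y : Type*} [TopologicalSpace Y]
    [CompactSpace Y] [MeasurableSpace Y] {Δ : Set (ProbabilityMeasure Y)}
    (hΔ : SmallBoundaryProperty Δ) {K U : Set Y} (hK : IsClosed K) (hU : IsOpen U)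
    (hKU : K ⊆ U) :
    ∃ V, IsClosed V ∧ K ⊆ interior V ∧ V ⊆ U ∧ ∀ ν ∈ Δ, (ν : Measure Y) (frontier V) = 0 := by
  refine hK.isCompact.induction_on (p := fun S ↦ ∃ V, IsClosed V ∧ S ⊆ interior V ∧ V ⊆ U ∧
    ∀ ν ∈ Δ, (ν : Measure Y) (frontier V) = 0) ?_ ?_ ?_ ?_
  · exact ⟨∅, isClosed_empty, Set.empty_subset _, Set.empty_subset _, by simp⟩
  · rintro S T hST ⟨V, hV, hTV, h⟩
    exact ⟨V, hV, hST.trans hTV, h⟩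
  · rintro S T ⟨V, hV, hSV, hVU, h⟩ ⟨V', hV', hTV, hVU', h'⟩
    refine ⟨V ∪ V', hV.union hV', ?_, Set.union_subset hVU hVU', fun ν hν ↦ ?_⟩
    · exact (Set.union_subset_union hSV hTV).trans subset_interior_union
    · refine measure_mono_null (t := frontier V ∪ frontier V') ?_
        (measure_union_null (h ν hν) (h' ν hν))
      exact (frontier_union_subset V V').trans
        (Set.union_subset_union Set.inter_subset_left Set.inter_subset_right)
  · intro y hy
    obtain ⟨V, hV, hyV, hVU, h⟩ := hΔ y U hU (hKU hy)
    refine ⟨interior V, mem_nhdsWithin_of_mem_nhds (isOpen_interior.mem_nhds hyV), V, hV,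
      subset_rfl, hVU, fun ν hν ↦ ?_⟩
    exact (ProbabilityMeasure.null_iff_toMeasure_null ν _).1 (h ν hν)

/-- The small boundary property follows once any closed-open pair `C ⊆ U` can be strictly refined
to a pair whose difference is uniformly small. -/
theorem smallBoundaryProperty_of_forall_exists_pair {X : Type*} [TopologicalSpace X] [T1Space X]
    [MeasurableSpace X] {Δ : Set (ProbabilityMeasure X)}
    (h : ∀ C U : Set X, IsClosed C → IsOpen U → C ⊆ U → ∀ ε : ℝ, 0 < ε →
      ∃ C' U' : Set X, IsClosed C' ∧ IsOpen U' ∧ C ⊆ interior C' ∧ C' ⊆ U' ∧ closure U' ⊆ U ∧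
        ∀ μ ∈ Δ, (μ : Measure X).real (U' \ C') ≤ ε) :
    SmallBoundaryProperty Δ := by
  intro x U hU hxU
  let P := {p : Set X × Set X // IsClosed p.1 ∧ IsOpen p.2 ∧ p.1 ⊆ p.2}
  have hstep : ∀ (n : ℕ) (p : P), ∃ q : P, p.1.1 ⊆ interior q.1.1 ∧ closure q.1.2 ⊆ p.1.2 ∧
      ∀ μ ∈ Δ, (μ : Measure X).real (q.1.2 \ q.1.1) ≤ 1 / ((n : ℝ) + 1) := by
    rintro n ⟨⟨C, V⟩, hC, hV, hCV⟩
    obtain ⟨C', V', hC', hV', h1, h2, h3, h4⟩ :=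
      h C V hC hV hCV (1 / ((n : ℝ) + 1)) (by positivity)
    exact ⟨⟨⟨C', V'⟩, hC', hV', h2⟩, h1, h3, h4⟩
  choose next hnext_int hnext_cl hnext_meas using hstep
  let s : ℕ → P := fun n ↦ Nat.rec
    ⟨({x}, U), isClosed_singleton, hU, Set.singleton_subset_iff.2 hxU⟩ next n
  have hC_int (n : ℕ) : (s n).1.1 ⊆ interior (s (n + 1)).1.1 := hnext_int n (s n)
  have hU_cl (n : ℕ) : closure (s (n + 1)).1.2 ⊆ (s n).1.2 := hnext_cl n (s n)
  have hmeas (n : ℕ) : ∀ μ ∈ Δ, (μ : Measure X).real ((s (n + 1)).1.2 \ (s (n + 1)).1.1) ≤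
      1 / ((n : ℝ) + 1) := hnext_meas n (s n)
  have hmono : Monotone fun n ↦ (s n).1.1 :=
    monotone_nat_of_le_succ fun n ↦ (hC_int n).trans interior_subset
  have hanti : Antitone fun n ↦ (s n).1.2 :=
    antitone_nat_of_succ_le fun n ↦ subset_closure.trans (hU_cl n)
  have hCU (m n : ℕ) : (s m).1.1 ⊆ (s n).1.2 :=
    (hmono (le_max_left m n)).trans ((s (max m n)).2.2.2.trans (hanti (le_max_right m n)))
  set V : Set X := ⋂ n, closure (s n).1.2 with hVdef
  have hVU (n : ℕ) : V ⊆ (s n).1.2 := (Set.iInter_subset _ (n + 1)).trans (hU_cl n)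
  have hCV (n : ℕ) : (s n).1.1 ⊆ interior V := (hC_int n).trans <|
    interior_mono <| Set.subset_iInter fun m ↦ (hCU (n + 1) m).trans subset_closure
  have hVcl : IsClosed V := isClosed_iInter fun n ↦ isClosed_closure
  refine ⟨V, hVcl, hCV 0 rfl, hVU 0, fun μ hμ ↦ ?_⟩
  rw [ProbabilityMeasure.null_iff_toMeasure_null, ← measureReal_eq_zero_iff]
  refine le_antisymm (ge_of_tendsto' tendsto_one_div_add_atTop_nhds_zero_nat fun n ↦ ?_)
    measureReal_nonneg
  refine (measureReal_mono ?_).trans (hmeas n μ hμ)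
  rw [hVcl.frontier_eq]
  exact Set.sdiff_subset_sdiff (hVU (n + 1)) (hCV (n + 1))

/-- A unital star-homomorphism between algebras of continuous functions on compact Hausdorff
spaces is composition with a continuous map. -/
theorem StarAlgHom.exists_continuousMap_eq_comp {X Y : Type*} [TopologicalSpace X]
    [CompactSpace X] [T2Space X] [TopologicalSpace Y] [CompactSpace Y]
    (φ : C(X, ℂ) →⋆ₐ[ℂ] C(Y, ℂ)) : ∃ p : C(Y, X), ∀ f, φ f = f.comp p := by
  let e := WeakDual.CharacterSpace.homeoEval X ℂ
  let q : C(Y, WeakDual.characterSpace ℂ C(X, ℂ)) :=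
    (WeakDual.CharacterSpace.compContinuousMap φ).comp
      (WeakDual.CharacterSpace.continuousMapEval Y ℂ)
  refine ⟨(e.symm : C(_, _)).comp q, fun f ↦ ContinuousMap.ext fun y ↦ ?_⟩
  have h : e (e.symm (q y)) f = q y f := by rw [e.apply_symm_apply]
  exact h.symm

theorem integral_sq_norm_lt_of_uniformTraceNormC_lt {Y : Type*} [TopologicalSpace Y]
    [CompactSpace Y] [MeasurableSpace Y] [BorelSpace Y] {Δ : Set (ProbabilityMeasure Y)}
    {h : C(Y, ℂ)} {η : ℝ} (hη : uniformTraceNormC Δ h < η) {ν : ProbabilityMeasure Y}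
    (hν : ν ∈ Δ) : ∫ y, ‖h y‖ ^ 2 ∂(ν : Measure Y) < η ^ 2 := by
  have hbound (ν : ProbabilityMeasure Y) :
      Real.sqrt (∫ y, ‖h y‖ ^ 2 ∂(ν : Measure Y)) ≤ ‖h‖ := by
    refine Real.sqrt_le_iff.2 ⟨norm_nonneg _, ?_⟩
    have hle := integral_mono_of_nonneg (μ := (ν : Measure Y)) (f := fun y ↦ ‖h y‖ ^ 2)
      (g := fun _ ↦ ‖h‖ ^ 2) (Eventually.of_forall fun y ↦ by positivity) (integrable_const _)
      (Eventually.of_forall fun y ↦ pow_le_pow_left₀ (norm_nonneg _) (h.norm_coe_le_norm y) 2)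
    simpa using hle
  have hbdd : BddAbove (Set.range fun ν : ProbabilityMeasure Y ↦
      ⨆ _ : ν ∈ Δ, Real.sqrt (∫ y, ‖h y‖ ^ 2 ∂(ν : Measure Y))) := by
    refine ⟨‖h‖, ?_⟩
    rintro _ ⟨ν, rfl⟩
    exact Real.iSup_le (fun _ ↦ hbound ν) (norm_nonneg _)
  have hle : Real.sqrt (∫ y, ‖h y‖ ^ 2 ∂(ν : Measure Y)) ≤ uniformTraceNormC Δ h := by
    refine le_trans ?_ (le_ciSup hbdd ν)
    simp [hν]
  exact (Real.sqrt_lt' ((Real.sqrt_nonneg _).trans_lt (hle.trans_lt hη))).1 (hle.trans_lt hη)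

/-- Probability measures related by integration of complex continuous functions along `p` are
related by push-forward. -/
theorem map_eq_of_forall_integral_comp_eq {X Y : Type*} [TopologicalSpace X] [CompactSpace X]
    [HasOuterApproxClosed X] [MeasurableSpace X] [BorelSpace X] [TopologicalSpace Y]
    [MeasurableSpace Y] [BorelSpace Y] (p : C(Y, X)) (μ : Measure X) [IsFiniteMeasure μ]
    (ν : Measure Y) [IsFiniteMeasure ν]
    (h : ∀ f : C(X, ℂ), ∫ x, f x ∂μ = ∫ y, f (p y) ∂ν) : μ = ν.map p := by
  refine ext_of_forall_integral_eq_of_IsFiniteMeasure fun f ↦ ?_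
  rw [integral_map p.continuous.aemeasurable f.continuous.aestronglyMeasurable]
  have hf := h ⟨fun x ↦ (f x : ℂ), Complex.continuous_ofReal.comp f.continuous⟩
  simp only [ContinuousMap.coe_mk, integral_complex_ofReal] at hf
  exact_mod_cast hf

/-- Under the small boundary property, the sublevel set `f ≤ a` and the superlevel set `b ≤ f` of a
continuous function are separated by a continuous function
taking only the values `0` and `1` off a uniformly small open set. -/
theorem SmallBoundaryProperty.exists_almost_indicator {Y : Type*} [TopologicalSpace Y]
    [CompactSpace Y] [TopologicalSpace.MetrizableSpace Y] [MeasurableSpace Y] [BorelSpace Y]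
    {Δ : Set (ProbabilityMeasure Y)} (hΔ : IsClosed Δ) (hSBP : SmallBoundaryProperty Δ)
    (f : C(Y, ℝ)) {a b ε : ℝ} (hab : a < b) (hε : 0 < ε) :
    ∃ (h : C(Y, ℝ)) (W : Set Y), (∀ ν ∈ Δ, (ν : Measure Y).real W ≤ ε) ∧
      (∀ y, f y ≤ a → h y = 0) ∧ (∀ y, b ≤ f y → h y = 1) ∧
      ∀ y, y ∉ W → h y = 0 ∨ h y = 1 := by
  obtain ⟨D, hD, hKD, hDU, hD0⟩ := hSBP.exists_isClosed_between_s7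
    (K := {y | f y ≤ a}) (U := {y | f y < b}) (isClosed_le f.continuous continuous_const)
    (isOpen_lt f.continuous continuous_const) fun y (hy : f y ≤ a) ↦ hy.trans_lt hab
  obtain ⟨W₀, hW₀, hDW₀, hW₀ε⟩ := hΔ.isCompact.exists_isOpen_superset_forall_measure_lt
    isClosed_frontier hD0 (ENNReal.ofReal_pos.2 hε)
  let W : Set Y := W₀ ∩ {y | a < f y ∧ f y < b}
  have hW : IsOpen W := hW₀.inter
    ((isOpen_lt continuous_const f.continuous).inter (isOpen_lt f.continuous continuous_const))
  have hDW : frontier D ⊆ W := by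
    refine fun y hy ↦ ⟨hDW₀ hy, ?_, hDU (hD.frontier_subset hy)⟩
    by_contra! hya
    exact hy.2 (hKD hya)
  have hDWo : IsOpen (D ∪ W) := by
    have : D ∪ W = interior D ∪ W := by
      refine subset_antisymm (Set.union_subset (fun y hy ↦ ?_) Set.subset_union_right)
        (Set.union_subset_union_left _ interior_subset)
      by_cases hyi : y ∈ interior D
      · exact Or.inl hyi
      · exact Or.inr (hDW ⟨subset_closure hy, hyi⟩)
    exact this ▸ isOpen_interior.union hW
  obtain ⟨h, h0, h1, -⟩ := exists_continuous_zero_one_of_isClosed (s := D \ W) (t := (D ∪ W)ᶜ)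
    (hD.sdiff hW) hDWo.isClosed_compl
    (Set.disjoint_compl_right_iff_subset.2 (Set.sdiff_subset.trans Set.subset_union_left))
  refine ⟨h, W, fun ν hν ↦ ?_, fun y hy ↦ ?_, fun y hy ↦ ?_, fun y hy ↦ ?_⟩
  · exact ENNReal.toReal_le_of_le_ofReal hε.le
      ((measure_mono Set.inter_subset_left).trans (hW₀ε ν hν).le)
  · exact h0 ⟨interior_subset (hKD hy), fun hyW ↦ hyW.2.1.not_ge hy⟩
  · refine h1 ?_
    rintro (hyD | hyW)
    · exact (hDU hyD : f y < b).not_ge hy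
    · exact hyW.2.2.not_ge hy
  · by_cases hyD : y ∈ D
    · exact Or.inl (h0 ⟨hyD, hy⟩)
    · exact Or.inr (h1 fun hy' ↦ hy'.elim hyD hy)

theorem sbp_of_trace_norm_dense_embedding
    {X : Type*} [TopologicalSpace X] [CompactSpace X] [TopologicalSpace.MetrizableSpace X]
    [MeasurableSpace X] [BorelSpace X]
    {Y : Type*} [TopologicalSpace Y] [CompactSpace Y] [TopologicalSpace.MetrizableSpace Y]
    [MeasurableSpace Y] [BorelSpace Y]
    (Δ₁ : Set (ProbabilityMeasure X)) (hΔ₁ : IsClosed Δ₁)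
    (Δ₂ : Set (ProbabilityMeasure Y)) (hΔ₂ : IsClosed Δ₂)
    (φ : C(X, ℂ) →⋆ₐ[ℂ] C(Y, ℂ)) (hinj : Function.Injective φ)
    (hpull : ∀ μ ∈ Δ₁, ∃ ν ∈ Δ₂, ∀ f : C(X, ℂ),
      (∫ x, f x ∂(μ : Measure X)) = ∫ y, (φ f) y ∂(ν : Measure Y))
    (hdense : ∀ (h : C(Y, ℂ)) (η : ℝ), 0 < η →
      ∃ f : C(X, ℂ), uniformTraceNormC Δ₂ (h - φ f) < η)
    (hSBP : SmallBoundaryProperty Δ₂) :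
    SmallBoundaryProperty Δ₁ := by
  obtain ⟨p, hp⟩ := φ.exists_continuousMap_eq_comp
  refine smallBoundaryProperty_of_forall_exists_pair fun C U hC hU hCU ε hε ↦ ?_
  obtain ⟨f, hf0, hf1, -⟩ := exists_continuous_zero_one_of_isClosed hC hU.isClosed_compl
    (Set.disjoint_compl_right_iff_subset.2 hCU)
  obtain ⟨h, W, hWε, hh0, hh1, hhW⟩ := hSBP.exists_almost_indicator hΔ₂ (f.comp p)
    (show (1 / 3 : ℝ) < 2 / 3 by norm_num) (half_pos hε)
  let hc : C(Y, ℂ) := ⟨fun y ↦ (h y : ℂ), Complex.continuous_ofReal.comp h.continuous⟩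
  obtain ⟨G, hG⟩ := hdense hc (Real.sqrt (ε / 18)) (Real.sqrt_pos.2 (by positivity))
  have hg : Continuous fun x ↦ (G x).re := Complex.continuous_re.comp G.continuous
  let C' : Set X := ({x | (G x).re ≤ 1 / 3} ∪ {x | f x ≤ 1 / 6}) ∩ {x | f x ≤ 2 / 3}
  let U' : Set X := ({x | (G x).re < 2 / 3} ∪ {x | f x < 1 / 3}) ∩ {x | f x < 5 / 6}
  have hC' : IsClosed C' := ((isClosed_le hg continuous_const).union
    (isClosed_le f.continuous continuous_const)).inter (isClosed_le f.continuous continuous_const)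
  have hU' : IsOpen U' := ((isOpen_lt hg continuous_const).union
    (isOpen_lt f.continuous continuous_const)).inter (isOpen_lt f.continuous continuous_const)
  refine ⟨C', U', hC', hU', fun x hx ↦ ?_, ?_, ?_, fun μ hμ ↦ ?_⟩
  · refine interior_maximal (t := {x | f x < 1 / 6}) (fun z (hz : f z < 1 / 6) ↦ ?_)
      (isOpen_lt f.continuous continuous_const) ?_
    · exact ⟨Or.inr hz.le, show f z ≤ 2 / 3 by linarith⟩
    · have : f x = 0 := hf0 hx
      simp [this]
  · rintro x ⟨hx | hx, hx'⟩ <;> simp only [Set.mem_ofPred_eq] at hx hx'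
    · exact ⟨Or.inl (show (G x).re < 2 / 3 by linarith), show f x < 5 / 6 by linarith⟩
    · exact ⟨Or.inr (show f x < 1 / 3 by linarith), show f x < 5 / 6 by linarith⟩
  · refine (closure_minimal (t := {x | f x ≤ 5 / 6}) (fun x hx ↦ (show f x < 5 / 6 from hx.2).le)
      (isClosed_le f.continuous continuous_const)).trans fun x (hx : f x ≤ 5 / 6) ↦ ?_
    by_contra hxU
    have : f x = 1 := hf1 hxU
    norm_num [this] at hx
  · obtain ⟨ν, hν, hμν⟩ := hpull μ hμ
    have hmap : (μ : Measure X) = (ν : Measure Y).map p :=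
      map_eq_of_forall_integral_comp_eq p _ _ fun F ↦ by
        rw [hμν F, hp F]
        rfl
    rw [hmap, map_measureReal_apply p.continuous.measurable
      (hU'.measurableSet.diff hC'.measurableSet)]
    let E : Set Y := {y | 1 / 9 ≤ ‖(hc - φ G) y‖ ^ 2}
    have hint := integral_sq_norm_lt_of_uniformTraceNormC_lt hG hν
    rw [Real.sq_sqrt (by positivity)] at hint
    have hE : (ν : Measure Y).real E ≤ ε / 2 := by
      have hmarkov := mul_meas_ge_le_integral_of_nonneg (μ := (ν : Measure Y))
        (f := fun y ↦ ‖(hc - φ G) y‖ ^ 2) (Eventually.of_forall fun y ↦ by positivity)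
        (((hc - φ G).continuous.norm.pow 2).integrable_of_hasCompactSupport
          (HasCompactSupport.of_compactSpace _)) (1 / 9)
      change 1 / 9 * (ν : Measure Y).real E ≤ _ at hmarkov
      linarith
    have hsub : p ⁻¹' (U' \ C') ⊆ W ∪ E := by
      rintro y ⟨⟨hyU, hyU'⟩, hyC⟩
      by_contra hy
      obtain ⟨hyW, hyE⟩ := not_or.1 hy
      have habs : |h y - (G (p y)).re| < 1 / 3 := by
        have hre : h y - (G (p y)).re = ((hc - φ G) y).re := by simp [hp, hc]
        refine (hre ▸ Complex.abs_re_le_norm _).trans_lt ?_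
        have hyE' : ‖(hc - φ G) y‖ ^ 2 < 1 / 9 := not_le.1 hyE
        exact lt_of_pow_lt_pow_left₀ 2 (by norm_num) (by linarith)
      rw [abs_lt] at habs
      have h0 : f (p y) ≤ 1 / 3 → h y = 0 := hh0 y
      have h1 : 2 / 3 ≤ f (p y) → h y = 1 := hh1 y
      have h01 := hhW y hyW
      simp only [C', Set.mem_inter_iff, Set.mem_union, Set.mem_ofPred_eq] at hyU hyU' hyC
      grind
    calc (ν : Measure Y).real (p ⁻¹' (U' \ C')) ≤ (ν : Measure Y).real (W ∪ E) :=
          measureReal_mono hsub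
      _ ≤ (ν : Measure Y).real W + (ν : Measure Y).real E := measureReal_union_le _ _
      _ ≤ ε / 2 + ε / 2 := add_le_add (hWε ν hν) hE
      _ = ε := add_halves ε
end

section
/- Let X be a compact metrizable topological space and let Δ be a weak-*-closed set of Borel probability measures on X, and assume (X, Δ) has the small boundary property. Let f : X → ℝ be continuous and let ε > 0. Then there are sequences (g_n) and (h_n) of continuous real-valued functions on X such that for each n = 1, 2, ...: (1) ‖f − g_n‖_∞ < ε; (2) ∫_X |g_n h_n − 1|² dμ < 1/2^n for all μ ∈ Δ; (3) ‖h_n‖_∞ < 4/ε; and (4) ‖g_n − g_{n+1}‖_{2,Δ} < 1/2^n and ‖h_n − h_{n+1}‖_{2,Δ} < 1/2^n. -/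
open MeasureTheory Filter Topology
open scoped NNReal ENNReal

section Cutoff

variable {X : Type*} [TopologicalSpace X] [MeasurableSpace X]

/-- A set of measures that all vanish on the closed set `F` vanishes uniformly near `F`. -/
theorem exists_cutoff_integral_lt [CompactSpace X] [TopologicalSpace.MetrizableSpace X]
    [BorelSpace X]
    {Δ : Set (ProbabilityMeasure X)} (hΔ : IsClosed Δ) {F : Set X} (hF : IsClosed F)
    (hnull : ∀ μ ∈ Δ, μ F = 0) {δ : ℝ} (hδ : 0 < δ) :
    ∃ φ : C(X, ℝ), (∀ x, 0 ≤ φ x) ∧ (∀ x, φ x ≤ 1) ∧ (∀ x ∈ F, φ x = 1) ∧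
      ∀ μ ∈ Δ, ∫ x, φ x ∂(μ : Measure X) < δ := by
  let _ : MetricSpace X := TopologicalSpace.metrizableSpaceMetric X
  have hpos (n : ℕ) : (0 : ℝ) < 1 / ((n : ℝ) + 1) := Nat.one_div_pos_of_nat
  let φ : ℕ → C(X, ℝ) := fun n =>
    ⟨fun x => (thickenedIndicator (hpos n) F x : ℝ), by fun_prop⟩
  have hanti {m n : ℕ} (hmn : m ≤ n) (x : X) : φ n x ≤ φ m x := by
    have := thickenedIndicator_mono (hpos n) (hpos m) (Nat.one_div_le_one_div hmn) F x
    exact NNReal.coe_le_coe.2 this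
  have hint (n : ℕ) (μ : ProbabilityMeasure X) : Integrable (φ n) (μ : Measure X) :=
    (φ n).continuous.integrable_of_hasCompactSupport (HasCompactSupport.of_compactSpace _)
  have hcont (n : ℕ) : Continuous fun μ : ProbabilityMeasure X => ∫ x, φ n x ∂(μ : Measure X) :=
    ProbabilityMeasure.continuous_integral_boundedContinuousFunction
      (BoundedContinuousFunction.mkOfCompact (φ n))
  obtain ⟨n, hn⟩ := hΔ.isCompact.elim_directed_cover
    (fun n => {μ : ProbabilityMeasure X | ∫ x, φ n x ∂(μ : Measure X) < δ})
    (fun n => isOpen_lt (hcont n) continuous_const)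
    (fun μ hμ => by
      have hlim := tendsto_integral_thickenedIndicator_of_isClosed (μ : Measure X) hF hpos
        tendsto_one_div_add_atTop_nhds_zero_nat
      have hzero : (μ : Measure X).real F = 0 := by
        rw [Measure.real, ← ProbabilityMeasure.ennreal_coeFn_eq_coeFn_toMeasure, hnull μ hμ]
        simp
      rw [hzero] at hlim
      obtain ⟨n, hn⟩ := (hlim.eventually (gt_mem_nhds hδ)).exists
      exact Set.mem_iUnion.2 ⟨n, hn⟩)
    (Monotone.directed_le fun m n hmn μ hμ =>
      (integral_mono (hint n μ) (hint m μ) (hanti hmn)).trans_lt hμ)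
  refine ⟨φ n, fun x => NNReal.coe_nonneg _, fun x => ?_, fun x hx => ?_, fun μ hμ => hn hμ⟩
  · exact NNReal.coe_le_one.2 (thickenedIndicator_le_one (hpos n) F x)
  · exact NNReal.coe_eq_one.2 (thickenedIndicator_one (hpos n) F hx)

/-- Under the small boundary property, a compact set and the complement of an open neighbourhood
are separated by a set with null boundary. -/
theorem SmallBoundaryProperty.exists_between {Δ : Set (ProbabilityMeasure X)}
    (hSBP : SmallBoundaryProperty Δ) {K U : Set X} (hK : IsCompact K) (hU : IsOpen U)
    (hKU : K ⊆ U) :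
    ∃ V : Set X, K ⊆ V ∧ V ⊆ U ∧ ∀ μ ∈ Δ, μ (frontier V) = 0 := by
  refine hK.induction_on (p := fun S => ∃ V : Set X, S ⊆ V ∧ V ⊆ U ∧ ∀ μ ∈ Δ, μ (frontier V) = 0)
    ⟨∅, by simp⟩ ?_ ?_ ?_
  · rintro S T hST ⟨V, hTV, hV⟩
    exact ⟨V, hST.trans hTV, hV⟩
  · rintro S T ⟨V, hSV, hVU, hV⟩ ⟨W, hTW, hWU, hW⟩
    refine ⟨V ∪ W, Set.union_subset_union hSV hTW, Set.union_subset hVU hWU, fun μ hμ => ?_⟩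
    have hsub : frontier (V ∪ W) ⊆ frontier V ∪ frontier W :=
      (frontier_union_subset V W).trans
        (Set.union_subset_union Set.inter_subset_left Set.inter_subset_right)
    refine le_antisymm ((μ.apply_mono hsub).trans ((μ.apply_union_le).trans ?_)) zero_le
    rw [hV μ hμ, hW μ hμ, add_zero]
  · intro x hx
    obtain ⟨V, -, hxV, hVU, hV⟩ := hSBP x U hU (hKU hx)
    exact ⟨V, mem_nhdsWithin_of_mem_nhds (mem_interior_iff_mem_nhds.1 hxV), V, subset_rfl, hVU, hV⟩

theorem integral_sq_le_of_abs_le_s8 [CompactSpace X] [OpensMeasurableSpace X] (μ : Measure X)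
    [IsFiniteMeasure μ] {u φ : C(X, ℝ)} {M : ℝ} (hφ : ∀ x, φ x ≤ 2)
    (hu : ∀ x, |u x| ≤ M * φ x) (hφ₀ : ∀ x, 0 ≤ φ x) :
    ∫ x, (u x) ^ 2 ∂μ ≤ 2 * M ^ 2 * ∫ x, φ x ∂μ := by
  rw [← integral_const_mul]
  refine integral_mono
    (Continuous.integrable_of_hasCompactSupport (by fun_prop) (HasCompactSupport.of_compactSpace _))
    (Continuous.integrable_of_hasCompactSupport (by fun_prop) (HasCompactSupport.of_compactSpace _))
    fun x => ?_
  calc (u x) ^ 2 = |u x| ^ 2 := (sq_abs _).symm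
    _ ≤ (M * φ x) ^ 2 := by gcongr; exact hu x
    _ = M ^ 2 * (φ x * φ x) := by ring
    _ ≤ M ^ 2 * (2 * φ x) := by gcongr; exacts [hφ₀ x, hφ x]
    _ = 2 * M ^ 2 * φ x := by ring

theorem uniformTraceNorm_le {Δ : Set (ProbabilityMeasure X)} {u : C(X, ℝ)} {c : ℝ} (hc : 0 ≤ c)
    (hu : ∀ μ ∈ Δ, ∫ x, (u x) ^ 2 ∂(μ : Measure X) ≤ c ^ 2) : uniformTraceNorm Δ u ≤ c :=
  Real.iSup_le (fun μ => Real.iSup_le (fun hμ => Real.sqrt_le_iff.2 ⟨hc, hu μ hμ⟩) hc) hc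

end Cutoff

section Push

/-- The number `t` pushed up towards `ε / 2`, by at most `5 * ε / 6`. -/
noncomputable def pushUp (ε t : ℝ) : ℝ := max t (min (ε / 2) (t + 5 * ε / 6))

/-- The number `t` pushed down towards `-ε / 2`, by at most `5 * ε / 6`. -/
noncomputable def pushDown (ε t : ℝ) : ℝ := -pushUp ε (-t)

/-- A convex combination of `pushUp` and `pushDown`. -/
noncomputable def blend (ε w t : ℝ) : ℝ := w * pushUp ε t + (1 - w) * pushDown ε t

/-- An approximate inverse of `blend`. -/
noncomputable def blendInv (ε w t : ℝ) : ℝ :=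
  w * (max t (ε / 2))⁻¹ - (1 - w) * (max (-t) (ε / 2))⁻¹

variable {ε t w w' φ B : ℝ}

theorem le_pushUp : t ≤ pushUp ε t := le_max_left _ _

theorem pushUp_le (hε : 0 < ε) : pushUp ε t ≤ t + 5 * ε / 6 :=
  max_le (by linarith) (min_le_right _ _)

theorem pushUp_eq (ht : -(ε / 3) < t) : pushUp ε t = max t (ε / 2) := by
  rw [pushUp, min_eq_left (by linarith)]

theorem pushDown_le : pushDown ε t ≤ t := by
  have := le_pushUp (ε := ε) (t := -t)
  unfold pushDown
  linarith

theorem le_pushDown (hε : 0 < ε) : t - 5 * ε / 6 ≤ pushDown ε t := by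
  have := pushUp_le (t := -t) hε
  unfold pushDown
  linarith

theorem blend_neg : blend ε (1 - w) (-t) = -blend ε w t := by
  simp only [blend, pushDown, neg_neg]
  ring

theorem blendInv_neg : blendInv ε (1 - w) (-t) = -blendInv ε w t := by
  simp only [blendInv, neg_neg]
  ring

theorem abs_sub_blend_le (hε : 0 < ε) (hw₀ : 0 ≤ w) (hw₁ : w ≤ 1) :
    |t - blend ε w t| ≤ 5 * ε / 6 := by
  have h₁ := le_pushUp (ε := ε) (t := t)
  have h₂ := pushUp_le (t := t) hε
  have h₃ := pushDown_le (ε := ε) (t := t)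
  have h₄ := le_pushDown (t := t) hε
  unfold blend
  rw [abs_le]
  constructor <;> nlinarith

theorem inv_max_half_nonneg (hε : 0 < ε) : 0 ≤ (max t (ε / 2))⁻¹ :=
  inv_nonneg.2 ((half_pos hε).le.trans (le_max_right _ _))

theorem inv_max_half_le (hε : 0 < ε) : (max t (ε / 2))⁻¹ ≤ 2 / ε := by
  rw [← inv_div ε 2]
  exact inv_anti₀ (half_pos hε) (le_max_right _ _)

theorem abs_blendInv_le (hε : 0 < ε) (hw₀ : 0 ≤ w) (hw₁ : w ≤ 1) :
    |blendInv ε w t| ≤ 2 / ε := by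
  have h₁ := inv_max_half_nonneg (t := t) hε
  have h₂ := inv_max_half_le (t := t) hε
  have h₃ := inv_max_half_nonneg (t := -t) hε
  have h₄ := inv_max_half_le (t := -t) hε
  unfold blendInv
  rw [abs_le]
  constructor <;> nlinarith

theorem abs_blend_sub_blend_le (hε : 0 < ε) :
    |blend ε w t - blend ε w' t| ≤ 2 * ε * |w - w'| := by
  have h₁ := le_pushUp (ε := ε) (t := t)
  have h₂ := pushUp_le (t := t) hε
  have h₃ := pushDown_le (ε := ε) (t := t)
  have h₄ := le_pushDown (t := t) hε
  have : blend ε w t - blend ε w' t = (pushUp ε t - pushDown ε t) * (w - w') := by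
    unfold blend; ring
  rw [this, abs_mul]
  gcongr
  rw [abs_le]
  constructor <;> linarith

theorem abs_blendInv_sub_blendInv_le (hε : 0 < ε) :
    |blendInv ε w t - blendInv ε w' t| ≤ 4 / ε * |w - w'| := by
  have h₁ := inv_max_half_nonneg (t := t) hε
  have h₂ := inv_max_half_le (t := t) hε
  have h₃ := inv_max_half_nonneg (t := -t) hε
  have h₄ := inv_max_half_le (t := -t) hε
  have h₅ : 4 / ε = 2 / ε + 2 / ε := by ring
  have : blendInv ε w t - blendInv ε w' t
      = ((max t (ε / 2))⁻¹ + (max (-t) (ε / 2))⁻¹) * (w - w') := by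
    unfold blendInv; ring
  rw [this, abs_mul]
  gcongr
  rw [abs_le]
  constructor <;> linarith

theorem abs_blend_mul_blendInv_sub_one_le (hε : 0 < ε) (ht : -(ε / 3) < t) (htB : |t| ≤ B)
    (hφ₀ : 0 ≤ φ) (hφ₁ : φ ≤ 1) :
    |blend ε (1 - φ / 2) t * blendInv ε (1 - φ / 2) t - 1| ≤ (3 + B / ε) * φ := by
  set P := max t (ε / 2)
  have hP₀ : 0 < P := (half_pos hε).trans_le (le_max_right _ _)
  have hPB : P ≤ B + ε / 2 := max_le (by linarith [le_abs_self t]) (by linarith [abs_nonneg t])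
  have hq₁ := pushDown_le (ε := ε) (t := t)
  have hq₂ := le_pushDown (t := t) hε
  have hPt : P ≤ t + 5 * ε / 6 := max_le (by linarith) (by linarith)
  have htP : t ≤ P := le_max_left _ _
  have hR₀ := inv_max_half_nonneg (t := -t) hε
  have hR₁ := inv_max_half_le (t := -t) hε
  have hh := abs_blendInv_le (t := t) (w := 1 - φ / 2) hε (by linarith) (by linarith)
  set R := (max (-t) (ε / 2))⁻¹
  set q := pushDown ε t
  have key : blend ε (1 - φ / 2) t * blendInv ε (1 - φ / 2) t - 1
      = φ / 2 * ((q - P) * blendInv ε (1 - φ / 2) t - (P * R + 1)) := by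
    have hb : blend ε (1 - φ / 2) t = P + φ / 2 * (q - P) := by
      have hb' : blend ε (1 - φ / 2) t = (1 - φ / 2) * P + (1 - (1 - φ / 2)) * q := by
        rw [blend, pushUp_eq ht]
      rw [hb']; ring
    have hi : P * blendInv ε (1 - φ / 2) t = 1 - φ / 2 * (P * R + 1) := by
      have hi' : blendInv ε (1 - φ / 2) t = (1 - φ / 2) * P⁻¹ - (1 - (1 - φ / 2)) * R := rfl
      rw [hi']
      linear_combination (1 - φ / 2) * mul_inv_cancel₀ hP₀.ne'
    rw [hb, add_mul, hi]; ring
  have h₁ : |(q - P) * blendInv ε (1 - φ / 2) t| ≤ 4 := by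
    rw [abs_mul]
    calc |q - P| * |blendInv ε (1 - φ / 2) t| ≤ (2 * ε) * (2 / ε) := by
          gcongr
          rw [abs_le]
          constructor <;> linarith
      _ = 4 := by field_simp; norm_num
  have h₂ : |P * R + 1| ≤ 2 + 2 * (B / ε) := by
    rw [abs_of_nonneg (by positivity)]
    have : P * R ≤ (B + ε / 2) * (2 / ε) := by gcongr; linarith
    have : (B + ε / 2) * (2 / ε) = 1 + 2 * (B / ε) := by field_simp; ring
    linarith
  rw [key, abs_mul, abs_of_nonneg (by positivity)]
  calc φ / 2 * |(q - P) * blendInv ε (1 - φ / 2) t - (P * R + 1)|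
      ≤ φ / 2 * (4 + (2 + 2 * (B / ε))) := by
        gcongr
        exact (abs_sub _ _).trans (add_le_add h₁ h₂)
    _ = (3 + B / ε) * φ := by ring

end Push

section Approximants

variable {X : Type*} [TopologicalSpace X]

/-- Continuous approximation of `f` of the form `blend`. -/
noncomputable def blendMap (ε : ℝ) (w f : C(X, ℝ)) : C(X, ℝ) where
  toFun x := blend ε (w x) (f x)
  continuous_toFun := by unfold blend pushDown pushUp; fun_prop

/-- Continuous approximate inverse of `blendMap`. -/
noncomputable def blendInvMap {ε : ℝ} (hε : 0 < ε) (w f : C(X, ℝ)) : C(X, ℝ) where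
  toFun x := blendInv ε (w x) (f x)
  continuous_toFun := by
    have hne (t : ℝ) : max t (ε / 2) ≠ 0 := ((half_pos hε).trans_le (le_max_right _ _)).ne'
    unfold blendInv
    refine .sub (.mul (by fun_prop) (.inv₀ (by fun_prop) fun x => hne _))
      (.mul (by fun_prop) (.inv₀ (by fun_prop) fun x => hne _))

open Classical in
/-- The function `1 - φ / 2` on `V` and `φ / 2` off `V`: a continuous approximation of the
indicator function of `V`, for `φ` equal to `1` on the boundary of `V`. -/
noncomputable def softIndicator (V : Set X) (φ : C(X, ℝ)) (hφ : ∀ x ∈ frontier V, φ x = 1) :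
    C(X, ℝ) where
  toFun x := if x ∈ V then 1 - φ x / 2 else φ x / 2
  continuous_toFun := Continuous.if (p := (· ∈ V))
    (fun x hx => by rw [hφ x hx]; norm_num) (by fun_prop) (by fun_prop)

variable {V : Set X} {φ ψ f : C(X, ℝ)} {ε : ℝ}

theorem softIndicator_of_mem (hφ : ∀ x ∈ frontier V, φ x = 1) {x : X}
    (hx : x ∈ V) : softIndicator V φ hφ x = 1 - φ x / 2 := if_pos hx

theorem softIndicator_of_notMem (hφ : ∀ x ∈ frontier V, φ x = 1)
    {x : X} (hx : x ∉ V) : softIndicator V φ hφ x = φ x / 2 := if_neg hx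

theorem softIndicator_mem_Icc (hφ : ∀ x ∈ frontier V, φ x = 1) {x : X} (h₀ : 0 ≤ φ x)
    (h₁ : φ x ≤ 1) : softIndicator V φ hφ x ∈ Set.Icc (0 : ℝ) 1 := by
  by_cases hx : x ∈ V
  · rw [softIndicator_of_mem hφ hx]
    constructor <;> linarith
  · rw [softIndicator_of_notMem hφ hx]
    constructor <;> linarith

theorem abs_softIndicator_sub_le (hφ : ∀ x ∈ frontier V, φ x = 1)
    (hψ : ∀ x ∈ frontier V, ψ x = 1) {x : X} (hφ₀ : 0 ≤ φ x) (hψ₀ : 0 ≤ ψ x) :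
    |softIndicator V φ hφ x - softIndicator V ψ hψ x| ≤ (φ x + ψ x) / 2 := by
  rw [abs_le]
  by_cases hx : x ∈ V
  · rw [softIndicator_of_mem hφ hx, softIndicator_of_mem hψ hx]
    constructor <;> linarith
  · rw [softIndicator_of_notMem hφ hx, softIndicator_of_notMem hψ hx]
    constructor <;> linarith

theorem abs_blendMap_mul_blendInvMap_sub_one_le [CompactSpace X] (hε : 0 < ε)
    (hV₁ : ∀ x ∈ V, -(ε / 3) < f x) (hV₂ : ∀ x ∉ V, f x < ε / 3)
    (hφ : ∀ x ∈ frontier V, φ x = 1) {x : X} (h₀ : 0 ≤ φ x) (h₁ : φ x ≤ 1) :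
    |blendMap ε (softIndicator V φ hφ) f x * blendInvMap hε (softIndicator V φ hφ) f x - 1|
      ≤ (3 + ‖f‖ / ε) * φ x := by
  have hf : |f x| ≤ ‖f‖ := f.norm_coe_le_norm x
  change |blend ε (softIndicator V φ hφ x) _ * blendInv ε (softIndicator V φ hφ x) _ - 1| ≤ _
  by_cases hx : x ∈ V
  · rw [softIndicator_of_mem hφ hx]
    exact abs_blend_mul_blendInv_sub_one_le hε (hV₁ x hx) hf h₀ h₁
  · rw [softIndicator_of_notMem hφ hx]
    have := abs_blend_mul_blendInv_sub_one_le (t := -f x) (B := ‖f‖) hε (by linarith [hV₂ x hx])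
      (by rwa [abs_neg]) h₀ h₁
    rwa [blend_neg, blendInv_neg, neg_mul_neg] at this

end Approximants

theorem sbp_approx_sequences
    {X : Type*} [TopologicalSpace X] [CompactSpace X] [TopologicalSpace.MetrizableSpace X]
    [MeasurableSpace X] [BorelSpace X]
    (Δ : Set (ProbabilityMeasure X)) (hΔ : IsClosed Δ)
    (hSBP : SmallBoundaryProperty Δ)
    (f : C(X, ℝ)) (ε : ℝ) (hε : 0 < ε) :
    ∃ g h : ℕ → C(X, ℝ), ∀ n : ℕ, 1 ≤ n →
      ‖f - g n‖ < ε ∧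
      (∀ μ ∈ Δ, (∫ x, (g n x * h n x - 1) ^ 2 ∂(μ : Measure X)) < 1 / 2 ^ n) ∧
      ‖h n‖ < 4 / ε ∧
      uniformTraceNorm Δ (g n - g (n + 1)) < 1 / 2 ^ n ∧
      uniformTraceNorm Δ (h n - h (n + 1)) < 1 / 2 ^ n := by
  obtain ⟨V, hKV, hVU, hV⟩ := hSBP.exists_between (K := {x | ε / 3 ≤ f x})
    (U := {x | -(ε / 3) < f x}) (isClosed_le continuous_const f.continuous).isCompact
    (isOpen_lt continuous_const f.continuous) fun x (hx : ε / 3 ≤ f x) =>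
      show -(ε / 3) < f x by linarith
  have hVc (x : X) (hx : x ∉ V) : f x < ε / 3 := not_le.1 fun h => hx (hKV h)
  set M : ℝ := 3 + ‖f‖ / ε + ε + 2 / ε with hM
  have hM₀ : 0 < M := by positivity
  have hδ (n : ℕ) : 0 < 1 / (8 * M ^ 2 * 4 ^ n) := by positivity
  choose φ hφ₀ hφ₁ hφ hint using fun n : ℕ =>
    exists_cutoff_integral_lt hΔ isClosed_frontier hV (hδ n)
  let w (n : ℕ) : C(X, ℝ) := softIndicator V (φ n) (hφ n)
  have hw (n : ℕ) (x : X) : w n x ∈ Set.Icc (0 : ℝ) 1 :=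
    softIndicator_mem_Icc (hφ n) (hφ₀ n x) (hφ₁ n x)
  have hwsub (n : ℕ) (x : X) : |w n x - w (n + 1) x| ≤ (φ n x + φ (n + 1) x) / 2 :=
    abs_softIndicator_sub_le (hφ n) (hφ (n + 1)) (hφ₀ n x) (hφ₀ (n + 1) x)
  have hφsum (n : ℕ) (x : X) : 0 ≤ φ n x + φ (n + 1) x := add_nonneg (hφ₀ n x) (hφ₀ (n + 1) x)
  have hquarter (n : ℕ) : 2 * M ^ 2 * (1 / (8 * M ^ 2 * 4 ^ n)) = (1 / 4) * (1 / 4 ^ n) := by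
    field_simp; norm_num
  have htrace (n : ℕ) (u : C(X, ℝ)) (hu : ∀ x, |u x| ≤ M * (φ n x + φ (n + 1) x)) :
      uniformTraceNorm Δ u < 1 / 2 ^ n := by
    have hpow : (0 : ℝ) < 1 / 2 ^ n := by positivity
    refine (uniformTraceNorm_le (c := 3 / 4 * (1 / 2 ^ n)) (by positivity) fun μ hμ => ?_).trans_lt
      (by linarith)
    have hle := integral_sq_le_of_abs_le_s8 (μ : Measure X) (u := u) (φ := φ n + φ (n + 1)) (M := M)
      (fun x => by simpa using by linarith [hφ₁ n x, hφ₁ (n + 1) x]) hu (hφsum n)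
    have hsplit : ∫ x, (φ n + φ (n + 1)) x ∂(μ : Measure X)
        = ∫ x, φ n x ∂(μ : Measure X) + ∫ x, φ (n + 1) x ∂(μ : Measure X) :=
      integral_add
        ((φ n).continuous.integrable_of_hasCompactSupport (HasCompactSupport.of_compactSpace _))
        ((φ (n + 1)).continuous.integrable_of_hasCompactSupport
          (HasCompactSupport.of_compactSpace _))
    have h4 : (1 / 2 ^ n : ℝ) ^ 2 = 1 / 4 ^ n := by
      rw [div_pow, one_pow, ← pow_mul, mul_comm, pow_mul]; norm_num
    have h4' : (1 / 4 ^ (n + 1) : ℝ) ≤ 1 / 4 ^ n := by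
      gcongr <;> norm_num
    have h1 : 2 * M ^ 2 * ∫ x, φ n x ∂(μ : Measure X) ≤ _ :=
      mul_le_mul_of_nonneg_left (hint n μ hμ).le (by positivity)
    have h2 : 2 * M ^ 2 * ∫ x, φ (n + 1) x ∂(μ : Measure X) ≤ _ :=
      mul_le_mul_of_nonneg_left (hint (n + 1) μ hμ).le (by positivity)
    rw [hquarter] at h1 h2
    rw [hsplit, mul_add] at hle
    rw [mul_pow, h4]
    have : (0 : ℝ) < 1 / 4 ^ n := by positivity
    linarith
  refine ⟨fun n => blendMap ε (w n) f, fun n => blendInvMap hε (w n) f, fun n _ =>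
    ⟨?_, fun μ hμ => ?_, ?_, htrace n _ fun x => ?_, htrace n _ fun x => ?_⟩⟩
  · refine ((ContinuousMap.norm_le _ (by positivity)).2 fun x =>
      abs_sub_blend_le hε (hw n x).1 (hw n x).2).trans_lt (by linarith)
  · have hle := integral_sq_le_of_abs_le_s8 (μ : Measure X)
      (u := blendMap ε (w n) f * blendInvMap hε (w n) f - 1) (φ := φ n) (M := M)
      (fun x => (hφ₁ n x).trans one_le_two) (fun x =>
        (abs_blendMap_mul_blendInvMap_sub_one_le hε (fun x hx => hVU hx) hVc (hφ n) (hφ₀ n x)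
          (hφ₁ n x)).trans (mul_le_mul_of_nonneg_right
            (by rw [hM]; linarith [hε, show 0 < 2 / ε by positivity]) (hφ₀ n x))) (hφ₀ n)
    refine hle.trans_lt ?_
    have h1 : 2 * M ^ 2 * ∫ x, φ n x ∂(μ : Measure X) ≤ _ :=
      mul_le_mul_of_nonneg_left (hint n μ hμ).le (by positivity)
    rw [hquarter] at h1
    have h4 : (1 / 4 ^ n : ℝ) ≤ 1 / 2 ^ n := by gcongr; norm_num
    have : (0 : ℝ) < 1 / 2 ^ n := by positivity
    linarith
  · refine ((ContinuousMap.norm_le _ (by positivity)).2 fun x =>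
      abs_blendInv_le hε (hw n x).1 (hw n x).2).trans_lt ?_
    gcongr
    norm_num
  · calc |blend ε (w n x) (f x) - blend ε (w (n + 1) x) (f x)|
        ≤ 2 * ε * ((φ n x + φ (n + 1) x) / 2) :=
          (abs_blend_sub_blend_le hε).trans (by gcongr; exact hwsub n x)
      _ = ε * (φ n x + φ (n + 1) x) := by ring
      _ ≤ M * (φ n x + φ (n + 1) x) := by
          gcongr
          · exact hφsum n x
          · rw [hM]
            linarith [show 0 < 2 / ε by positivity, show 0 ≤ ‖f‖ / ε by positivity]
  · calc |blendInv ε (w n x) (f x) - blendInv ε (w (n + 1) x) (f x)|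
        ≤ 4 / ε * ((φ n x + φ (n + 1) x) / 2) :=
          (abs_blendInv_sub_blendInv_le hε).trans (by gcongr; exact hwsub n x)
      _ = 2 / ε * (φ n x + φ (n + 1) x) := by ring
      _ ≤ M * (φ n x + φ (n + 1) x) := by
          gcongr
          · exact hφsum n x
          · rw [hM]
            linarith [show 0 ≤ ‖f‖ / ε by positivity]
end
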